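/- arXiv:2603.26301 — 2 statements merged into one kernel-verified Lean document; each statement's English description precedes it below -/
import Mathlib

section
/- Let M=(I,V,E) be an iMAG. Then for all node sets A,B,C⊆I∪V: A is id-separated from B given C in M if and only if, for every isADMG A'∈[M]_G, A is id-separated from B given C∪S_{A'} in A'. -/
noncomputable section
open Classical

/-- Edge-endpoint marks: tail `−`, arrowhead `>`, or circle `∘`. -/
inductive Mark : Type
  | tail
  | arrow
  | circle
  deriving DecidableEq

/-- A mixed graph with input nodes over a node type `N`, as raw data.
`mark a b` is the mark at `a` on the (unique) edge between `a` and `b`,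
or `none` if there is no edge between `a` and `b`. -/
structure MixedGraph (N : Type) where
  inputs : Set N
  outputs : Set N
  mark : N → N → Option Mark

namespace MixedGraph

variable {N N' : Type}

/-- All nodes of the graph. -/
def nodes (G : MixedGraph N) : Set N := G.inputs ∪ G.outputs

/-- `a` and `b` are adjacent (joined by an edge). -/
def adj (G : MixedGraph N) (a b : N) : Prop := (G.mark a b).isSome

/-- Directed edge `a → b`: tail at `a`, arrowhead at `b`. -/
def dir (G : MixedGraph N) (a b : N) : Prop :=
  G.mark a b = some Mark.tail ∧ G.mark b a = some Mark.arrow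

/-- Bidirected edge `a ↔ b`. -/
def bidir (G : MixedGraph N) (a b : N) : Prop :=
  G.mark a b = some Mark.arrow ∧ G.mark b a = some Mark.arrow

/-- Undirected edge `a − b`. -/
def undir (G : MixedGraph N) (a b : N) : Prop :=
  G.mark a b = some Mark.tail ∧ G.mark b a = some Mark.tail

/-- Edge `a ∘→ b`: circle at `a`, arrowhead at `b`. -/
def circArrow (G : MixedGraph N) (a b : N) : Prop :=
  G.mark a b = some Mark.circle ∧ G.mark b a = some Mark.arrow

/-- Edge `a ∘−∘ b`: circles at both ends. -/
def circCirc (G : MixedGraph N) (a b : N) : Prop :=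
  G.mark a b = some Mark.circle ∧ G.mark b a = some Mark.circle

/-- Edge `a ∘− b`: circle at `a`, tail at `b`. -/
def circTail (G : MixedGraph N) (a b : N) : Prop :=
  G.mark a b = some Mark.circle ∧ G.mark b a = some Mark.tail

/-- Edge `a −∘ b`: tail at `a`, circle at `b`. -/
def tailCirc (G : MixedGraph N) (a b : N) : Prop :=
  G.mark a b = some Mark.tail ∧ G.mark b a = some Mark.circle

/-- Some edge of `G` carries an arrowhead at `a`. -/
def arrowAt (G : MixedGraph N) (a : N) : Prop :=
  ∃ b, G.mark a b = some Mark.arrow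

/-- `a` is an ancestor of `b`: `a = b` or a directed path `a → ⋯ → b` exists. -/
def anc (G : MixedGraph N) : N → N → Prop := Relation.ReflTransGen G.dir

/-- The ancestors of a set `S` of nodes. -/
def ancSet (G : MixedGraph N) (S : Set N) : Set N := {a | ∃ s ∈ S, G.anc a s}

/-- Potentially directed edge from `a` towards `b`: an edge with no arrowhead at its
earlier endpoint `a` and no tail at its later endpoint `b`. -/
def potDir (G : MixedGraph N) (a b : N) : Prop :=
  G.adj a b ∧ G.mark a b ≠ some Mark.arrow ∧ G.mark b a ≠ some Mark.tail

/-- `a` is a possible ancestor of `b`: `a = b` or a potentially directed path runs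
from `a` to `b`. -/
def poAn (G : MixedGraph N) : N → N → Prop := Relation.ReflTransGen G.potDir

/-- The possible ancestors of a set `S` of nodes. -/
def poAnSet (G : MixedGraph N) (S : Set N) : Set N := {a | ∃ s ∈ S, G.poAn a s}

/-- Well-formedness of a mixed graph with input nodes: inputs and outputs are disjoint
finite sets, edges are symmetric and irreflexive and join nodes of the graph. -/
def WF (G : MixedGraph N) : Prop :=
  Disjoint G.inputs G.outputs ∧ G.inputs.Finite ∧ G.outputs.Finite ∧
  (∀ a b, (G.mark a b).isSome → (G.mark b a).isSome) ∧
  (∀ a, G.mark a a = none) ∧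
  (∀ a b, (G.mark a b).isSome → a ∈ G.nodes ∧ b ∈ G.nodes)

/-- The induced subgraph of `G` over the node set `A`. -/
def induce (G : MixedGraph N) (A : Set N) : MixedGraph N where
  inputs := G.inputs ∩ A
  outputs := G.outputs ∩ A
  mark := fun a b => if a ∈ A ∧ b ∈ A then G.mark a b else none

/-- Transport a mixed graph over `N` to one over `N ⊕ N'` along `Sum.inl`. -/
def sumInl (G : MixedGraph N) : MixedGraph (N ⊕ N') where
  inputs := Sum.inl '' G.inputs
  outputs := Sum.inl '' G.outputs
  mark := fun x y =>
    match x, y with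
    | Sum.inl a, Sum.inl b => G.mark a b
    | _, _ => none

/-- `G` is a subgraph of `H`: its nodes and marked edges are among those of `H`. -/
def Subgraph (G H : MixedGraph N) : Prop :=
  G.inputs ⊆ H.inputs ∧ G.outputs ⊆ H.outputs ∧
  ∀ a b m, G.mark a b = some m → H.mark a b = some m

end MixedGraph

/-- A walk in `G` with `len` edges, visiting the nodes `f 0, …, f len`
(consecutive nodes are adjacent). -/
structure GWalk {N : Type} (G : MixedGraph N) where
  len : ℕ
  f : ℕ → N
  hadj : ∀ i < len, G.adj (f i) (f (i + 1))

namespace GWalk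

variable {N : Type} {G : MixedGraph N}

/-- The first node of the walk. -/
def first (w : GWalk G) : N := w.f 0

/-- The last node of the walk. -/
def last (w : GWalk G) : N := w.f w.len

/-- The walk is a path: no repeated nodes. -/
def IsPath (w : GWalk G) : Prop :=
  ∀ i ≤ w.len, ∀ j ≤ w.len, w.f i = w.f j → i = j

/-- The (interior) node at position `i` is a collider on the walk: both incident
edges carry arrowheads at it. -/
def ColliderAt (w : GWalk G) (i : ℕ) : Prop :=
  G.mark (w.f i) (w.f (i - 1)) = some Mark.arrow ∧
  G.mark (w.f i) (w.f (i + 1)) = some Mark.arrow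

end GWalk

namespace MixedGraph

variable {N : Type}

/-- `w` is an `(L,S)`-inducing walk: every non-endnode is in `L` or a collider, and
every collider lies in `Anc({first, last} ∪ S)`. -/
def InducingWalk (G : MixedGraph N) (L S : Set N) (w : GWalk G) : Prop :=
  (∀ i, 0 < i → i < w.len → w.f i ∈ L ∨ w.ColliderAt i) ∧
  (∀ i, 0 < i → i < w.len → w.ColliderAt i →
    w.f i ∈ G.ancSet ({w.first, w.last} ∪ S))

/-- There is an `(L,S)`-inducing walk from `a` to `b` in `G`. -/
def InducingWalkBtw (G : MixedGraph N) (L S : Set N) (a b : N) : Prop :=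
  ∃ w : GWalk G, w.first = a ∧ w.last = b ∧ G.InducingWalk L S w

/-- There is an `(L,S)`-inducing path from `a` to `b` in `G`. -/
def InducingPathBtw (G : MixedGraph N) (L S : Set N) (a b : N) : Prop :=
  ∃ w : GWalk G, w.IsPath ∧ w.first = a ∧ w.last = b ∧ G.InducingWalk L S w

/-- `G` is an iADMG: all edges directed or bidirected, no directed cycles, no
arrowheads at input nodes, and no edges between two input nodes. -/
def IsIADMG (G : MixedGraph N) : Prop :=
  G.WF ∧
  (∀ a b, G.adj a b → G.dir a b ∨ G.dir b a ∨ G.bidir a b) ∧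
  (∀ a b, G.dir a b → ¬ G.anc b a) ∧
  (∀ a ∈ G.inputs, ∀ b, G.mark a b ≠ some Mark.arrow) ∧
  (∀ a ∈ G.inputs, ∀ b ∈ G.inputs, ¬ G.adj a b)

/-- `G` is an iPAG. -/
def IsIPAG (G : MixedGraph N) : Prop :=
  G.WF ∧
  (∀ a ∈ G.inputs, ∀ b, G.mark a b ≠ some Mark.arrow) ∧
  (∀ a ∈ G.inputs, ∀ b ∈ G.inputs, ¬ G.adj a b) ∧
  (∀ a b, G.dir a b → ¬ G.anc b a) ∧
  (∀ a b, G.anc a b → ¬ G.bidir b a) ∧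
  (∀ a b c, G.mark b a = some Mark.arrow → ¬ G.undir b c) ∧
  (∀ a b, a ≠ b → a ∈ G.nodes → b ∈ G.nodes → ¬ G.adj a b →
    ¬ G.InducingPathBtw ∅ ∅ a b)

/-- `G` is an iMAG: an iPAG with no circle marks. -/
def IsIMAG (G : MixedGraph N) : Prop :=
  G.IsIPAG ∧ ∀ a b, G.mark a b ≠ some Mark.circle

/-- The visibility condition for a directed edge `a → b` of `G`: either `a` is an
input node, or some node `c` not adjacent to `b` satisfies `c *→ a`, or there is a
path `c *→ v₁ ↔ ⋯ ↔ v_{n−1} ↔ a` (`n ≥ 2`) with every `vᵢ` a parent of `b`. -/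
def VisibleCond (G : MixedGraph N) (a b : N) : Prop :=
  a ∈ G.inputs ∨
  ∃ c, c ≠ b ∧ ¬ G.adj c b ∧
    (G.mark a c = some Mark.arrow ∨
      ∃ w : GWalk G, w.IsPath ∧ 2 ≤ w.len ∧ w.first = c ∧ w.last = a ∧
        G.mark (w.f 1) (w.f 0) = some Mark.arrow ∧
        (∀ i, 1 ≤ i → i < w.len → G.bidir (w.f i) (w.f (i + 1))) ∧
        (∀ i, 1 ≤ i → i < w.len → G.dir (w.f i) b))

/-- `a → b` is a visible directed edge of `G`. -/
def VisibleDir (G : MixedGraph N) (a b : N) : Prop :=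
  G.dir a b ∧ G.VisibleCond a b

/-- `a` and `b` are in the same bucket of `G`: some path between them carries no
arrowhead mark on any of its edges. -/
def SameBucket (G : MixedGraph N) (a b : N) : Prop :=
  ∃ w : GWalk G, w.IsPath ∧ w.first = a ∧ w.last = b ∧
    ∀ i < w.len, G.mark (w.f i) (w.f (i + 1)) ≠ some Mark.arrow ∧
      G.mark (w.f (i + 1)) (w.f i) ≠ some Mark.arrow

end MixedGraph

/-- An isADMG: an iADMG together with its set `sel` of latent selection nodes.
The observed output nodes are `graph.outputs \ sel`. -/
structure SADMG (N : Type) where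
  graph : MixedGraph N
  sel : Set N

namespace SADMG

/-- Well-formedness of an isADMG. -/
def WF {N : Type} (A : SADMG N) : Prop :=
  A.graph.IsIADMG ∧ A.sel ⊆ A.graph.outputs

/-- The observed output nodes `O`. -/
def obs {N : Type} (A : SADMG N) : Set N := A.graph.outputs \ A.sel

end SADMG

/-- An ilsADMG: an iADMG together with its sets of latent output nodes and of
latent selection nodes.  The observed output nodes are the remaining outputs. -/
structure LSADMG (N : Type) where
  graph : MixedGraph N
  latent : Set N
  sel : Set N

namespace LSADMG

/-- Well-formedness of an ilsADMG. -/
def WF {N : Type} (A : LSADMG N) : Prop :=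
  A.graph.IsIADMG ∧ A.latent ⊆ A.graph.outputs ∧ A.sel ⊆ A.graph.outputs ∧
  Disjoint A.latent A.sel

/-- The observed output nodes `O`. -/
def obs {N : Type} (A : LSADMG N) : Set N := A.graph.outputs \ (A.latent ∪ A.sel)

end LSADMG

/-- An iPAG/iMAG `P` represents the isADMG `A`: nodes match; adjacency in `P`
corresponds exactly to `S`-inducing paths in `A` (with no edges inside the inputs);
arrowheads at `a` imply `a ∉ Anc_A({b} ∪ S)`; tails at `a` imply `a ∈ Anc_A({b} ∪ S)`. -/
def RepresentsS {N : Type} (P : MixedGraph N) (A : SADMG N) : Prop :=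
  P.inputs = A.graph.inputs ∧
  P.outputs = A.obs ∧
  (∀ a b, a ≠ b → a ∈ P.nodes → b ∈ P.nodes →
    (P.adj a b ↔
      (¬(a ∈ P.inputs ∧ b ∈ P.inputs) ∧ A.graph.InducingPathBtw ∅ A.sel a b))) ∧
  (∀ a b, P.mark a b = some Mark.arrow → a ∉ A.graph.ancSet ({b} ∪ A.sel)) ∧
  (∀ a b, P.mark a b = some Mark.tail → a ∈ A.graph.ancSet ({b} ∪ A.sel))

/-- An iPAG/iMAG `P` `(L,S)`-represents the ilsADMG `A`. -/
def RepresentsLS {N : Type} (P : MixedGraph N) (A : LSADMG N) : Prop :=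
  P.inputs = A.graph.inputs ∧
  P.outputs = A.obs ∧
  (∀ a b, a ≠ b → a ∈ P.nodes → b ∈ P.nodes →
    (P.adj a b ↔
      (¬(a ∈ P.inputs ∧ b ∈ P.inputs) ∧ A.graph.InducingPathBtw A.latent A.sel a b))) ∧
  (∀ a b, P.mark a b = some Mark.arrow → a ∉ A.graph.ancSet ({b} ∪ A.sel)) ∧
  (∀ a b, P.mark a b = some Mark.tail → a ∈ A.graph.ancSet ({b} ∪ A.sel))

/-- The explicit candidate for `MAG(A)` of an ilsADMG `A`: input nodes `I`, output
nodes `O`; distinct `a,b ∈ I ∪ O` adjacent iff `{a,b} ⊄ I` and there is an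
`(L,S)`-inducing path between them in `A`; the mark at `a` on each edge is a tail
if `a ∈ Anc_A({b} ∪ S)` and an arrowhead otherwise. -/
def magOfLS {N : Type} (A : LSADMG N) : MixedGraph N where
  inputs := A.graph.inputs
  outputs := A.obs
  mark := fun a b =>
    if a ≠ b ∧ a ∈ A.graph.inputs ∪ A.obs ∧ b ∈ A.graph.inputs ∪ A.obs ∧
        ¬(a ∈ A.graph.inputs ∧ b ∈ A.graph.inputs) ∧
        A.graph.InducingPathBtw A.latent A.sel a b then
      (if a ∈ A.graph.ancSet ({b} ∪ A.sel) then some Mark.tail else some Mark.arrow)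
    else none

/-- A walk is `C`-open (in a graph without circle marks): its endnodes are not in
`C`, no non-collider on it is in `C`, and every collider on it is in `Anc(C)`. -/
def COpen {N : Type} (H : MixedGraph N) (C : Set N) (w : GWalk H) : Prop :=
  w.first ∉ C ∧ w.last ∉ C ∧
  ∀ i, 0 < i → i < w.len →
    (¬ w.ColliderAt i → w.f i ∉ C) ∧ (w.ColliderAt i → w.f i ∈ H.ancSet C)

/-- `A` is id-separated from `B` given `C` in `H` (graphs without circle marks):
every path/walk from a node of `A` to a node of `B ∪ inputs` is not `C`-open. -/
def IdSepSimple {N : Type} (H : MixedGraph N) (A B C : Set N) : Prop :=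
  ∀ w : GWalk H, w.first ∈ A → w.last ∈ B ∪ H.inputs → ¬ COpen H C w

/-- A walk in a manipulated graph `H` (with set `DI` of regime input nodes) is
`C`-id-open. -/
def IdOpen {N : Type} (H : MixedGraph N) (DI C : Set N) (w : GWalk H) : Prop :=
  w.first ∉ C ∧ w.last ∉ C ∧
  ∀ i, 0 < i → i < w.len →
    (w.f i ∉ C ∧ (H.mark (w.f i) (w.f (i - 1)) = some Mark.tail ∨
        H.mark (w.f i) (w.f (i + 1)) = some Mark.tail)) ∨
    (w.f i ∉ C ∧ H.mark (w.f i) (w.f (i - 1)) = some Mark.circle ∧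
        H.mark (w.f i) (w.f (i + 1)) = some Mark.circle ∧
        ¬ H.adj (w.f (i - 1)) (w.f (i + 1))) ∨
    (w.ColliderAt i ∧ w.f (i - 1) ∉ DI ∧ w.f i ∉ DI ∧ w.f (i + 1) ∉ DI ∧
        w.f i ∈ H.ancSet C) ∨
    (w.ColliderAt i ∧ ¬(w.f (i - 1) ∉ DI ∧ w.f i ∉ DI ∧ w.f (i + 1) ∉ DI) ∧
        w.f i ∈ H.poAnSet (C ∩ H.outputs)) ∨
    (w.f (i - 1) ∈ DI ∧ H.mark (w.f i) (w.f (i - 1)) = some Mark.circle ∧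
        H.mark (w.f i) (w.f (i + 1)) = some Mark.arrow ∧
        w.f i ∈ H.poAnSet (C ∩ H.outputs)) ∨
    (w.f (i + 1) ∈ DI ∧ H.mark (w.f i) (w.f (i - 1)) = some Mark.arrow ∧
        H.mark (w.f i) (w.f (i + 1)) = some Mark.circle ∧
        w.f i ∈ H.poAnSet (C ∩ H.outputs))

/-- `A` is id-separated from `B` given `C` in the manipulated graph `H`, whose set
of regime input nodes is `DI`: every path/walk from a node of `A` to a node of
`B ∪ inputs` is not `C`-id-open. -/
def IdSep {N : Type} (H : MixedGraph N) (DI A B C : Set N) : Prop :=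
  ∀ w : GWalk H, w.first ∈ A → w.last ∈ B ∪ H.inputs → ¬ IdOpen H DI C w

/-- Hard manipulation `do(T)` of an isADMG-type graph: reclassify the nodes of `T`
as input nodes and delete every edge with an arrowhead at a node of `T`. -/
def admgHardManip {N : Type} (G : MixedGraph N) (T : Set N) : MixedGraph N where
  inputs := G.inputs ∪ (T ∩ G.outputs)
  outputs := G.outputs \ T
  mark := fun x y =>
    if (x ∈ T ∧ G.mark x y = some Mark.arrow) ∨
        (y ∈ T ∧ G.mark y x = some Mark.arrow) then none
    else G.mark x y

/-- Soft manipulation `do(I_D)` of an isADMG-type graph: add a fresh input node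
`I_d = Sum.inr d` and the directed edge `I_d → d` for each `d ∈ D`. -/
def admgSoftManip {N : Type} (G : MixedGraph N) (D : Set N) : MixedGraph (N ⊕ N) where
  inputs := Sum.inl '' G.inputs ∪ Sum.inr '' D
  outputs := Sum.inl '' G.outputs
  mark := fun x y =>
    match x, y with
    | Sum.inl a, Sum.inl b => G.mark a b
    | Sum.inr d, Sum.inl a => if d ∈ D ∧ a = d then some Mark.tail else none
    | Sum.inl a, Sum.inr d => if d ∈ D ∧ a = d then some Mark.arrow else none
    | Sum.inr _, Sum.inr _ => none

/-- Soft manipulation of an isADMG. -/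
def SADMG.softManip {N : Type} (A : SADMG N) (D : Set N) : SADMG (N ⊕ N) where
  graph := admgSoftManip A.graph D
  sel := Sum.inl '' A.sel

/-- Hard manipulation `do(T)` of an iMAG-type graph: input nodes `I ∪ (T ∩ V)`,
output nodes `V \ T`; delete all edges with an arrowhead at a node of `T \ I` and
all edges between two nodes of `T ∪ I`. -/
def magHardManip {N : Type} (G : MixedGraph N) (T : Set N) : MixedGraph N where
  inputs := G.inputs ∪ (T ∩ G.outputs)
  outputs := G.outputs \ T
  mark := fun x y =>
    if (x ∈ T ∧ x ∉ G.inputs ∧ G.mark x y = some Mark.arrow) ∨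
        (y ∈ T ∧ y ∉ G.inputs ∧ G.mark y x = some Mark.arrow) ∨
        ((x ∈ T ∨ x ∈ G.inputs) ∧ (y ∈ T ∨ y ∈ G.inputs)) then none
    else G.mark x y

/-- The mark at node `y` on the new edge between the regime node `I_a = Sum.inr a`
and `y` in the soft manipulation of an iMAG-type graph `G` over `N ⊕ N`
(`none` if there is no such edge): `I_a → a` if some edge of `G` has an arrowhead
at `a`; `I_a − a` if some undirected edge is at `a`; `I_a −∘ a` otherwise;
`I_a → b` for every output `b` with `a → b` invisible; `I_a − b` for every output
`b` with `a − b` in `G`. -/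
def magSoftTarget {N : Type} (G : MixedGraph (N ⊕ N)) (a : N) (y : N ⊕ N) : Option Mark :=
  if y = Sum.inl a then
    (if G.arrowAt (Sum.inl a) then some Mark.arrow
     else if ∃ c, G.undir (Sum.inl a) c then some Mark.tail
     else some Mark.circle)
  else if y ∈ G.outputs ∧ G.dir (Sum.inl a) y ∧ ¬ G.VisibleCond (Sum.inl a) y then
    some Mark.arrow
  else if y ∈ G.outputs ∧ G.undir (Sum.inl a) y then some Mark.tail
  else none

/-- The mark at node `y` on the new edge between the regime node `I_a = Sum.inr a`
and `y` in the soft manipulation of an iPAG-type graph `G` over `N ⊕ N`. -/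
def pagSoftTarget {N : Type} (G : MixedGraph (N ⊕ N)) (a : N) (y : N ⊕ N) : Option Mark :=
  if y = Sum.inl a then
    (if G.arrowAt (Sum.inl a) then some Mark.arrow
     else if ∃ c, G.undir (Sum.inl a) c then some Mark.tail
     else some Mark.circle)
  else if y ∈ G.outputs ∧ ((G.dir (Sum.inl a) y ∧ ¬ G.VisibleCond (Sum.inl a) y) ∨
      G.circArrow (Sum.inl a) y) then some Mark.arrow
  else if y ∈ G.outputs ∧ (G.undir (Sum.inl a) y ∨
      (G.circTail (Sum.inl a) y ∧ ∃ c, G.undir c y)) then some Mark.tail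
  else if y ∈ G.outputs ∧ (G.tailCirc (Sum.inl a) y ∨ G.circCirc (Sum.inl a) y ∨
      (G.circTail (Sum.inl a) y ∧ ¬ ∃ c, G.undir c y)) then some Mark.circle
  else none

/-- Generic soft-manipulation step on a graph over `N ⊕ N`: for each `a ∈ A` not
already an input, the regime node `I_a = Sum.inr a` is added as an input node,
with edges (and end marks) prescribed by `target`; the mark at `I_a` on each new
edge is a tail. -/
def softManipStep {N : Type}
    (target : MixedGraph (N ⊕ N) → N → (N ⊕ N) → Option Mark)
    (G : MixedGraph (N ⊕ N)) (A : Set N) : MixedGraph (N ⊕ N) where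
  inputs := G.inputs ∪ Sum.inr '' {a | a ∈ A ∧ Sum.inl a ∉ G.inputs}
  outputs := G.outputs
  mark := fun x y =>
    match x, y with
    | Sum.inr a, Sum.inr b =>
        if a ∈ A ∧ Sum.inl a ∉ G.inputs then
          (if (target G a (Sum.inr b)).isSome then some Mark.tail else none)
        else if b ∈ A ∧ Sum.inl b ∉ G.inputs then target G b (Sum.inr a)
        else G.mark x y
    | Sum.inr a, Sum.inl v =>
        if a ∈ A ∧ Sum.inl a ∉ G.inputs then
          (if (target G a (Sum.inl v)).isSome then some Mark.tail else none)
        else G.mark x y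
    | Sum.inl v, Sum.inr a =>
        if a ∈ A ∧ Sum.inl a ∉ G.inputs then target G a (Sum.inl v)
        else G.mark x y
    | Sum.inl _, Sum.inl _ => G.mark x y

/-- Soft-manipulation step for iMAG-type graphs over `N ⊕ N`. -/
def magSoftManipStep {N : Type} (G : MixedGraph (N ⊕ N)) (A : Set N) :
    MixedGraph (N ⊕ N) :=
  softManipStep magSoftTarget G A

/-- The soft-manipulated iMAG `M_{do(I_A)}`, over node type `N ⊕ N`. -/
def magSoftManip {N : Type} (M : MixedGraph N) (A : Set N) : MixedGraph (N ⊕ N) :=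
  magSoftManipStep M.sumInl A

/-- The soft-manipulated iPAG `P_{do(I_A)}`, over node type `N ⊕ N`. -/
def pagSoftManip {N : Type} (P : MixedGraph N) (A : Set N) : MixedGraph (N ⊕ N) :=
  softManipStep pagSoftTarget P.sumInl A

/-- Hard manipulation `do(T)` of an iPAG-type graph: as for iMAGs, but in addition
every remaining circle mark at a manipulated node is replaced by a tail. -/
def pagHardManip {N : Type} (G : MixedGraph N) (T : Set N) : MixedGraph N where
  inputs := G.inputs ∪ T
  outputs := G.outputs \ T
  mark := fun x y =>
    if (x ∈ T ∧ x ∉ G.inputs ∧ G.mark x y = some Mark.arrow) ∨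
        (y ∈ T ∧ y ∉ G.inputs ∧ G.mark y x = some Mark.arrow) ∨
        ((x ∈ T ∨ x ∈ G.inputs) ∧ (y ∈ T ∨ y ∈ G.inputs)) then none
    else if x ∈ T ∧ x ∉ G.inputs ∧ y ∈ G.outputs ∧ y ∉ T ∧
        G.mark x y = some Mark.circle then some Mark.tail
    else G.mark x y

/-- Orient all circle marks of `G` as tails. -/
def orientCirclesTails {N : Type} (G : MixedGraph N) : MixedGraph N :=
  { G with
    mark := fun x y =>
      (G.mark x y).map (fun m => if m = Mark.circle then Mark.tail else m) }

/-- There is a pc-connecting path from `a` to `b` in `G`: a single edge between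
`a` and `b` that is not a visible directed edge, or a path
`a *→ v₁ ↔ ⋯ ↔ v_{n−1} ←* b` (`n > 1`) none of whose edges is visible directed. -/
def PcConn {N : Type} (G : MixedGraph N) (a b : N) : Prop :=
  (G.adj a b ∧ ¬ G.VisibleDir a b ∧ ¬ G.VisibleDir b a) ∨
  (∃ w : GWalk G, w.IsPath ∧ 1 < w.len ∧ w.first = a ∧ w.last = b ∧
    G.mark (w.f 1) (w.f 0) = some Mark.arrow ∧
    G.mark (w.f (w.len - 1)) (w.f w.len) = some Mark.arrow ∧
    (∀ i, 1 ≤ i → i < w.len - 1 → G.bidir (w.f i) (w.f (i + 1))) ∧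
    (∀ i < w.len, ¬ G.VisibleDir (w.f i) (w.f (i + 1)) ∧
      ¬ G.VisibleDir (w.f (i + 1)) (w.f i)))

/-- The pc-component of `b` in `G`. -/
def pcSet {N : Type} (G : MixedGraph N) (b : N) : Set N := {a | PcConn G a b}

/-- The region of a set `B` in `G`: all nodes in the bucket of some node
pc-connected to a node of `B`. -/
def regionSet {N : Type} (G : MixedGraph N) (B : Set N) : Set N :=
  {a | ∃ b ∈ B, ∃ c, PcConn G c b ∧ G.SameBucket a c}

/-- `S` is a bucket of `G`. -/
def IsBucket {N : Type} (G : MixedGraph N) (S : Set N) : Prop :=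
  ∃ a ∈ G.nodes, S = {x | G.SameBucket x a}

/-- FCI rule R1 (closure form): if `k *→ j` with the edge between `j` and `i`
carrying a circle at `j`, `i` and `k` non-adjacent and `i` not an input node,
then that edge is `j → i`. -/
def FciR1 {N : Type} (P : MixedGraph N) : Prop :=
  ∀ i j k, P.mark j k = some Mark.arrow → ¬ P.adj i k → i ∉ P.inputs →
    P.mark j i = some Mark.circle → P.dir j i

/-- FCI rule R2 (closure form): if `i → j *→ k` or `i *→ j → k` with the edge
between `i` and `k` carrying a circle at `k`, then that edge has an arrowhead at `k`. -/
def FciR2 {N : Type} (P : MixedGraph N) : Prop :=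
  ∀ i j k, ((P.dir i j ∧ P.mark k j = some Mark.arrow) ∨
      (P.mark j i = some Mark.arrow ∧ P.dir j k)) →
    P.mark k i = some Mark.circle → P.mark k i = some Mark.arrow

/-- FCI rule R4 (closure form): for every discriminating path `⟨a,…,y,z⟩` for `y`,
the mark at `y` on the edge between `y` and `z` is not a circle. -/
def FciR4 {N : Type} (P : MixedGraph N) : Prop :=
  ∀ w : GWalk P, w.IsPath → 3 ≤ w.len → ¬ P.adj (w.f 0) (w.f w.len) →
    (∀ i, 0 < i → i < w.len - 1 → w.ColliderAt i ∧ P.dir (w.f i) (w.f w.len)) →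
    P.mark (w.f (w.len - 1)) (w.f w.len) ≠ some Mark.circle

/-- Property (P2) of iSOPAGs: no `a *→ b` together with `b −∘ c`, and no
`a *→ b` together with `b ∘− c`. -/
def SopagP2 {N : Type} (P : MixedGraph N) : Prop :=
  ∀ a b c, P.mark b a = some Mark.arrow → ¬ P.tailCirc b c ∧ ¬ P.circTail b c

/-- Property (P3) of iSOPAGs: if `a *→ b` and the edge between `b` and `c` has a
circle at `b`, then `a *→ c`. -/
def SopagP3 {N : Type} (P : MixedGraph N) : Prop :=
  ∀ a b c, P.mark b a = some Mark.arrow → P.mark b c = some Mark.circle →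
    P.mark c a = some Mark.arrow

/-- `P` is an iSOPAG: an iPAG representing some isADMG, closed under the FCI
orientation rules (R1, R2, R4), and satisfying (P2) and (P3). -/
def IsISOPAG {N : Type} (P : MixedGraph N) : Prop :=
  P.IsIPAG ∧ (∃ A : SADMG N, A.WF ∧ RepresentsS P A) ∧
  FciR1 P ∧ FciR2 P ∧ FciR4 P ∧ SopagP2 P ∧ SopagP3 P


namespace MixedGraph

variable {N : Type} {G : MixedGraph N}

theorem ancSet_mono {S T : Set N} (h : S ⊆ T) : G.ancSet S ⊆ G.ancSet T :=
  fun _ ⟨s, hs, ha⟩ => ⟨s, h hs, ha⟩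

theorem subset_ancSet (S : Set N) : S ⊆ G.ancSet S :=
  fun s hs => ⟨s, hs, Relation.ReflTransGen.refl⟩

theorem mem_ancSet_of_anc {S : Set N} {a b : N} (h : G.anc a b) (hb : b ∈ G.ancSet S) :
    a ∈ G.ancSet S := by
  obtain ⟨s, hs, hbs⟩ := hb
  exact ⟨s, hs, h.trans hbs⟩

theorem ancSet_subset_of_subset {S T : Set N} (h : S ⊆ G.ancSet T) : G.ancSet S ⊆ G.ancSet T :=
  fun _ ⟨_, hs, ha⟩ => mem_ancSet_of_anc ha (h hs)

theorem mem_ancSet_union {S T : Set N} {a : N} :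
    a ∈ G.ancSet (S ∪ T) ↔ a ∈ G.ancSet S ∨ a ∈ G.ancSet T := by
  constructor
  · rintro ⟨s, hs | hs, h⟩
    · exact Or.inl ⟨s, hs, h⟩
    · exact Or.inr ⟨s, hs, h⟩
  · rintro (h | h)
    · exact ancSet_mono Set.subset_union_left h
    · exact ancSet_mono Set.subset_union_right h

theorem mem_ancSet_singleton {a b : N} : a ∈ G.ancSet {b} ↔ G.anc a b := by
  simp [ancSet]

theorem WF.adj_symm (h : G.WF) {a b : N} (hab : G.adj a b) : G.adj b a := h.2.2.2.1 a b hab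

theorem WF.ne_of_adj (h : G.WF) {a b : N} (hab : G.adj a b) : a ≠ b := by
  rintro rfl
  simp [adj, h.2.2.2.2.1 a] at hab

theorem WF.mem_nodes (h : G.WF) {a b : N} (hab : G.adj a b) : a ∈ G.nodes ∧ b ∈ G.nodes :=
  h.2.2.2.2.2 a b hab

theorem adj_of_mark {a b : N} {m : Mark} (h : G.mark a b = some m) : G.adj a b := by
  simp [adj, h]

theorem IsIADMG.dir_of_mark_tail (h : G.IsIADMG) {a b : N}
    (hab : G.mark a b = some Mark.tail) : G.dir a b := by
  rcases h.2.1 a b (adj_of_mark hab) with h1 | h1 | h1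
  · exact h1
  · exact absurd (h1.2.symm.trans hab) (by simp)
  · exact absurd (h1.1.symm.trans hab) (by simp)

theorem IsIADMG.mark_eq (h : G.IsIADMG) {a b : N} {m : Mark} (hab : G.mark a b = some m)
    (hm : m ≠ Mark.arrow) : m = Mark.tail := by
  rcases h.2.1 a b (adj_of_mark hab) with h1 | h1 | h1
  · exact (Option.some.inj (h1.1.symm.trans hab)).symm
  · exact absurd (Option.some.inj (h1.2.symm.trans hab)).symm hm
  · exact absurd (Option.some.inj (h1.1.symm.trans hab)).symm hm

/-- The reverse of a walk. -/
def reverseWalk (hG : G.WF) (w : GWalk G) : GWalk G where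
  len := w.len
  f i := w.f (w.len - i)
  hadj i hi := by
    have := w.hadj (w.len - (i + 1)) (by omega)
    rw [show w.len - (i + 1) + 1 = w.len - i by omega] at this
    exact hG.adj_symm this

/-- The walk obtained by deleting the closed subwalk between positions `i` and `j`. -/
def cutWalk (w : GWalk G) (i j : ℕ) (hij : i < j) (hj : j ≤ w.len) (h : w.f i = w.f j) :
    GWalk G where
  len := w.len - (j - i)
  f t := if t ≤ i then w.f t else w.f (t + (j - i))
  hadj t ht := by
    rcases lt_trichotomy t i with hlt | rfl | hlt
    · simpa [hlt.le, Nat.succ_le_of_lt hlt] using w.hadj t (by omega)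
    · have := w.hadj j (by omega)
      simp only [le_refl, if_true, show ¬ t + 1 ≤ t by omega, if_false]
      rwa [h, show t + 1 + (j - t) = j + 1 by omega]
    · have := w.hadj (t + (j - i)) (by omega)
      simp only [show ¬ t ≤ i by omega, show ¬ t + 1 ≤ i by omega, if_false]
      rwa [show t + 1 + (j - i) = t + (j - i) + 1 by omega]

/-- An inducing walk without latent nodes between distinct nodes can be shortened to an
inducing path. -/
theorem inducingPathBtw_of_inducingWalkBtw {S : Set N} {a b : N} (hab : a ≠ b)
    (h : G.InducingWalkBtw ∅ S a b) : G.InducingPathBtw ∅ S a b := by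
  let P : ℕ → Prop := fun n =>
    ∃ w : GWalk G, w.len = n ∧ w.first = a ∧ w.last = b ∧ G.InducingWalk ∅ S w
  have hP : ∃ n, P n := by
    obtain ⟨w, hw⟩ := h
    exact ⟨w.len, w, rfl, hw⟩
  obtain ⟨w, hlen, hfirst, hlast, hind⟩ := Nat.find_spec hP
  refine ⟨w, ?_, hfirst, hlast, hind⟩
  have key : ∀ i j, i < j → j ≤ w.len → w.f i ≠ w.f j := by
    intro i j hij hj heq
    have hends : ¬ (i = 0 ∧ j = w.len) := by
      rintro ⟨rfl, rfl⟩
      exact hab (hfirst.symm.trans (heq.trans hlast))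
    have hf : (cutWalk w i j hij hj heq).first = a := by
      simpa [cutWalk, GWalk.first] using hfirst
    have hl : (cutWalk w i j hij hj heq).last = b := by
      rw [← hlast]
      simp only [cutWalk, GWalk.last]
      split_ifs with hle
      · have : j = w.len := by omega
        subst this
        rw [← heq]
        congr 1
        omega
      · congr 1
        omega
    have hcol : ∀ t, 0 < t → t < w.len → w.ColliderAt t := by
      intro t h0 ht
      simpa using hind.1 t h0 ht
    refine Nat.find_min hP (m := w.len - (j - i)) (by omega)
      ⟨cutWalk w i j hij hj heq, rfl, hf, hl, ?_, ?_⟩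
    · intro t h0 ht
      right
      change t < w.len - (j - i) at ht
      rcases lt_trichotomy t i with hlt | rfl | hlt
      · have := hcol t h0 (by omega)
        simpa [GWalk.ColliderAt, cutWalk, hlt.le, Nat.succ_le_of_lt hlt,
          show t ≤ i + 1 by omega] using this
      · have h1 := (hcol t h0 (by omega)).1
        have h2 := (hcol j (by omega) (by omega)).2
        rw [← heq] at h2
        simp only [GWalk.ColliderAt, cutWalk, le_refl, if_true, Nat.sub_le,
          show ¬ t + 1 ≤ t by omega, if_false]
        rw [show t + 1 + (j - t) = j + 1 by omega]
        exact ⟨h1, h2⟩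
      · obtain ⟨h1, h2⟩ := hcol (t + (j - i)) (by omega) (by omega)
        simp only [GWalk.ColliderAt, cutWalk, show ¬ t ≤ i by omega,
          show ¬ t + 1 ≤ i by omega, if_false]
        rw [show t + 1 + (j - i) = t + (j - i) + 1 by omega]
        refine ⟨?_, h2⟩
        split_ifs with hle
        · have : t = i + 1 := by omega
          subst this
          rw [show i + 1 + (j - i) - 1 = j by omega] at h1
          rwa [show i + 1 - 1 = i by omega, heq]
        · rwa [show t - 1 + (j - i) = t + (j - i) - 1 by omega]
    · intro t h0 ht _
      change t < w.len - (j - i) at ht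
      rw [hf, hl]
      have hanc : ∀ t, 0 < t → t < w.len → w.f t ∈ G.ancSet ({a, b} ∪ S) := by
        intro t h0 ht
        have := hind.2 t h0 ht (hcol t h0 ht)
        rwa [hfirst, hlast] at this
      simp only [cutWalk]
      split_ifs with hle
      · exact hanc t h0 (by omega)
      · exact hanc _ (by omega) (by omega)
  intro i hi j hj heq
  rcases lt_trichotomy i j with hij | hij | hij
  · exact absurd heq (key i j hij hj)
  · exact hij
  · exact absurd heq.symm (key j i hij hi)

/-- There is a nontrivial `S`-inducing walk (without latent nodes) from `x` to `y` whose first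
edge carries the mark `p` at `x` and whose last edge carries the mark `q` at `y`. -/
def Seg (G : MixedGraph N) (S : Set N) (x : N) (p q : Mark) (y : N) : Prop :=
  ∃ w : GWalk G, 0 < w.len ∧ w.f 0 = x ∧ w.f w.len = y ∧
    G.mark (w.f 0) (w.f 1) = some p ∧ G.mark (w.f w.len) (w.f (w.len - 1)) = some q ∧
    ∀ i, 0 < i → i < w.len → w.ColliderAt i ∧ w.f i ∈ G.ancSet ({x, y} ∪ S)

namespace Seg

variable {S : Set N} {x y z : N} {p q q' r : Mark}

theorem of_edge (hp : G.mark x y = some p) (hq : G.mark y x = some q) : G.Seg S x p q y := by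
  refine ⟨⟨1, fun i => if i = 0 then x else y, ?_⟩, one_pos, by simp, by simp, by simpa,
    by simpa, ?_⟩
  · intro i hi
    obtain rfl : i = 0 := by omega
    simpa using adj_of_mark hp
  · intro i h0 h1
    change i < 1 at h1
    omega

theorem symm (hG : G.WF) (h : G.Seg S x p q y) : G.Seg S y q p x := by
  obtain ⟨w, hpos, h0, h1, hp, hq, hint⟩ := h
  refine ⟨reverseWalk hG w, hpos, by simpa [reverseWalk], by simpa [reverseWalk],
    by simpa [reverseWalk], ?_, ?_⟩
  · simp only [reverseWalk, Nat.sub_self]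
    rwa [show w.len - (w.len - 1) = 1 by omega]
  · intro i hi hi'
    change i < w.len at hi'
    obtain ⟨⟨ha, hb⟩, hc⟩ := hint (w.len - i) (by omega) (by omega)
    refine ⟨⟨?_, ?_⟩, ?_⟩
    · simp only [reverseWalk]
      rwa [show w.len - (i - 1) = w.len - i + 1 by omega]
    · simp only [reverseWalk]
      rwa [show w.len - (i + 1) = w.len - i - 1 by omega]
    · simpa only [reverseWalk, Set.pair_comm y x] using hc

/-- Two segments meeting in a collider that is an ancestor of the outer endnodes or of `S`
concatenate to a single segment. -/
theorem trans (h₁ : G.Seg S x p Mark.arrow y) (h₂ : G.Seg S y Mark.arrow r z)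
    (hy : y ∈ G.ancSet ({x, z} ∪ S)) : G.Seg S x p r z := by
  obtain ⟨w, hpos, h0, h1, hp, hq, hint⟩ := h₁
  obtain ⟨w', hpos', h0', h1', hp', hq', hint'⟩ := h₂
  have hx : x ∈ G.ancSet ({x, z} ∪ S) := subset_ancSet _ (by simp)
  have hz : z ∈ G.ancSet ({x, z} ∪ S) := subset_ancSet _ (by simp)
  have hS : S ⊆ G.ancSet ({x, z} ∪ S) := Set.subset_union_right.trans (subset_ancSet _)
  have hsub₁ : G.ancSet ({x, y} ∪ S) ⊆ G.ancSet ({x, z} ∪ S) :=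
    ancSet_subset_of_subset (by
      rintro u ((rfl | rfl) | hu)
      exacts [hx, hy, hS hu])
  have hsub₂ : G.ancSet ({y, z} ∪ S) ⊆ G.ancSet ({x, z} ∪ S) :=
    ancSet_subset_of_subset (by
      rintro u ((rfl | rfl) | hu)
      exacts [hy, hz, hS hu])
  let f : ℕ → N := fun i => if i ≤ w.len then w.f i else w'.f (i - w.len)
  have f_le : ∀ i, i ≤ w.len → f i = w.f i := fun i hi => if_pos hi
  have f_ge : ∀ i, w.len ≤ i → f i = w'.f (i - w.len) := by
    intro i hi
    rcases hi.eq_or_lt with rfl | hi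
    · simp [f, h1, h0']
    · exact if_neg (by omega)
  refine ⟨⟨w.len + w'.len, f, ?_⟩, ?_, ?_, ?_, ?_, ?_, ?_⟩
  · intro i hi
    rcases lt_or_ge i w.len with hlt | hge
    · rw [f_le i hlt.le, f_le (i + 1) hlt]
      exact w.hadj i hlt
    · rw [f_ge i hge, f_ge (i + 1) (by omega), show i + 1 - w.len = i - w.len + 1 by omega]
      exact w'.hadj _ (by omega)
  · exact Nat.add_pos_left hpos _
  · exact (f_le 0 (by omega)).trans h0
  · change f (w.len + w'.len) = z
    rw [f_ge _ (by omega), Nat.add_sub_cancel_left, h1']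
  · change G.mark (f 0) (f 1) = some p
    rwa [f_le 0 (by omega), f_le 1 (by omega)]
  · change G.mark (f (w.len + w'.len)) (f (w.len + w'.len - 1)) = some r
    rwa [f_ge _ (by omega), f_ge _ (by omega), Nat.add_sub_cancel_left,
      show w.len + w'.len - 1 - w.len = w'.len - 1 by omega]
  · intro i hi hi'
    change i < w.len + w'.len at hi'
    change (G.mark (f i) (f (i - 1)) = _ ∧ G.mark (f i) (f (i + 1)) = _) ∧ f i ∈ _
    rcases lt_trichotomy i w.len with hlt | rfl | hlt
    · obtain ⟨hc, ha⟩ := hint i hi hlt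
      rw [f_le i hlt.le, f_le (i - 1) (by omega), f_le (i + 1) hlt]
      exact ⟨hc, hsub₁ ha⟩
    · have hyw : f w.len = y := (f_le _ le_rfl).trans h1
      refine ⟨⟨?_, ?_⟩, hyw ▸ hy⟩
      · rwa [f_le _ le_rfl, f_le _ (Nat.sub_le _ _)]
      · rwa [f_ge _ le_rfl, f_ge (w.len + 1) (Nat.le_succ _), Nat.sub_self, Nat.add_sub_cancel_left]
    · obtain ⟨hc, ha⟩ := hint' (i - w.len) (by omega) (by omega)
      rw [f_ge i hlt.le, f_ge (i - 1) (by omega), f_ge (i + 1) (by omega),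
        show i - 1 - w.len = i - w.len - 1 by omega,
        show i + 1 - w.len = i - w.len + 1 by omega]
      exact ⟨hc, hsub₂ ha⟩

theorem exists_mark (h : G.Seg S x p q y) : ∃ u, G.mark x u = some p := by
  obtain ⟨w, -, h0, -, hp, -⟩ := h
  exact ⟨w.f 1, h0 ▸ hp⟩

theorem inducingWalkBtw (h : G.Seg S x p q y) : G.InducingWalkBtw ∅ S x y := by
  obtain ⟨w, hpos, h0, h1, hp, hq, hint⟩ := h
  refine ⟨w, h0, h1, fun i hi hi' => Or.inr (hint i hi hi').1, fun i hi hi' _ => ?_⟩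
  rw [GWalk.first, GWalk.last, h0, h1]
  exact (hint i hi hi').2

theorem exists_dir (hG : G.IsIADMG) (h : G.Seg S x p q y) (hp' : p ≠ Mark.arrow) :
    ∃ u, G.dir x u ∧ u ∈ G.ancSet ({y} ∪ S) := by
  obtain ⟨w, hpos, h0, h1, hp, hq, hint⟩ := h
  obtain rfl := hG.mark_eq hp hp'
  rw [h0] at hp
  have hdir := hG.dir_of_mark_tail hp
  refine ⟨w.f 1, hdir, ?_⟩
  rcases (Nat.succ_le_of_lt hpos).eq_or_lt with hlen | hlen
  · rw [show w.f 1 = y by rw [← h1, ← hlen]]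
    exact subset_ancSet _ (by simp)
  · obtain ⟨s, (rfl | hs) | hs, hanc⟩ := (hint 1 one_pos hlen).2
    · exact absurd hanc (hG.2.2.1 _ _ hdir)
    · exact ⟨s, Or.inl hs, hanc⟩
    · exact ⟨s, Or.inr hs, hanc⟩

theorem mem_ancSet_left (hG : G.IsIADMG) (h : G.Seg S x p q y) (hp : p ≠ Mark.arrow) :
    x ∈ G.ancSet ({y} ∪ S) := by
  obtain ⟨u, hxu, hu⟩ := h.exists_dir hG hp
  exact mem_ancSet_of_anc (Relation.ReflTransGen.single hxu) hu

theorem mem_ancSet_of_loop (hG : G.IsIADMG) (h : G.Seg S x p q x) (hp : p ≠ Mark.arrow) :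
    x ∈ G.ancSet S := by
  obtain ⟨u, hxu, s, rfl | hs, hus⟩ := h.exists_dir hG hp
  · exact absurd hus (hG.2.2.1 _ _ hxu)
  · exact ⟨s, hs, Relation.ReflTransGen.head hxu hus⟩

end Seg

/-- A `Z`-open chain of `k` consecutive `S`-inducing segments, with nodes `v 0, …, v k`; the
`t`-th segment carries the mark `p t` at `v t` and the mark `q t` at `v (t + 1)`. -/
structure SegChain (G : MixedGraph N) (S Z : Set N) (k : ℕ) where
  v : ℕ → N
  p : ℕ → Mark
  q : ℕ → Mark
  first_notMem : v 0 ∉ Z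
  last_notMem : v k ∉ Z
  seg : ∀ t < k, G.Seg S (v t) (p t) (q t) (v (t + 1))
  collider : ∀ t, t + 1 < k → q t = Mark.arrow → p (t + 1) = Mark.arrow →
    v (t + 1) ∈ G.ancSet Z
  nonCollider : ∀ t, t + 1 < k → (q t ≠ Mark.arrow ∨ p (t + 1) ≠ Mark.arrow) → v (t + 1) ∉ Z

namespace SegChain

variable {S Z : Set N} {k : ℕ}

theorem exists_of_cOpen (hG : G.WF) (w : GWalk G) (hw : COpen G Z w) :
    ∃ c : G.SegChain S Z w.len, c.v = w.f := by
  have hmark : ∀ a b, G.adj a b → G.mark a b = some ((G.mark a b).getD Mark.circle) := by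
    intro a b hab
    obtain ⟨m, hm⟩ := Option.isSome_iff_exists.mp hab
    simp [hm]
  have hadj' : ∀ t < w.len, G.adj (w.f (t + 1)) (w.f t) := fun t ht => hG.adj_symm (w.hadj t ht)
  have hiff : ∀ t, t + 1 < w.len →
      (w.ColliderAt (t + 1) ↔ (G.mark (w.f (t + 1)) (w.f t)).getD Mark.circle = Mark.arrow ∧
        (G.mark (w.f (t + 1)) (w.f (t + 1 + 1))).getD Mark.circle = Mark.arrow) := by
    intro t ht
    rw [GWalk.ColliderAt, hmark _ _ (w.hadj (t + 1) ht), Nat.add_sub_cancel,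
      hmark _ _ (hadj' t (by omega))]
    simp
  refine ⟨⟨w.f, fun t => (G.mark (w.f t) (w.f (t + 1))).getD Mark.circle,
    fun t => (G.mark (w.f (t + 1)) (w.f t)).getD Mark.circle, hw.1, hw.2.1, ?_, ?_, ?_⟩, rfl⟩
  · exact fun t ht => Seg.of_edge (hmark _ _ (w.hadj t ht)) (hmark _ _ (hadj' t ht))
  · intro t ht hq hp
    exact (hw.2.2 (t + 1) t.succ_pos ht).2 ((hiff t ht).2 ⟨hq, hp⟩)
  · intro t ht h
    refine (hw.2.2 (t + 1) t.succ_pos ht).1 fun hc => ?_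
    obtain ⟨hq, hp⟩ := (hiff t ht).1 hc
    exact h.elim (fun h => h hq) (fun h => h hp)

/-- A chain can be stopped at any node outside `Z`. -/
def take (c : G.SegChain S Z k) (t : ℕ) (ht : t ≤ k) (hv : c.v t ∉ Z) : G.SegChain S Z t where
  v := c.v
  p := c.p
  q := c.q
  first_notMem := c.first_notMem
  last_notMem := hv
  seg s hs := c.seg s (by omega)
  collider s hs := c.collider s (by omega)
  nonCollider s hs := c.nonCollider s (by omega)

/-- Merging the two segments that meet at `v (t + 1)`. -/
theorem exists_merge (c : G.SegChain S Z k) (t : ℕ) (ht : t + 1 < k)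
    (hq : c.q t = Mark.arrow) (hp : c.p (t + 1) = Mark.arrow)
    (hv : c.v (t + 1) ∈ G.ancSet ({c.v t, c.v (t + 2)} ∪ S)) :
    ∃ c' : G.SegChain S Z (k - 1), c'.v 0 = c.v 0 ∧ c'.v (k - 1) = c.v k := by
  refine ⟨⟨fun s => if s ≤ t then c.v s else c.v (s + 1),
    fun s => if s ≤ t then c.p s else c.p (s + 1),
    fun s => if s < t then c.q s else c.q (s + 1), ?_, ?_, ?_, ?_, ?_⟩, ?_, ?_⟩
  · simpa using c.first_notMem
  · rw [if_neg (by omega), show k - 1 + 1 = k by omega]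
    exact c.last_notMem
  · intro s hs
    rcases lt_trichotomy s t with h | rfl | h
    · rw [if_pos h.le, if_pos h.le, if_pos h, if_pos (Nat.succ_le_of_lt h)]
      exact c.seg s (by omega)
    · rw [if_pos le_rfl, if_pos le_rfl, if_neg (lt_irrefl _), if_neg (by omega)]
      have h₁ := c.seg s (by omega)
      have h₂ := c.seg (s + 1) ht
      rw [hq] at h₁
      rw [hp] at h₂
      exact h₁.trans h₂ hv
    · rw [if_neg (by omega), if_neg (by omega), if_neg (by omega), if_neg (by omega)]
      exact c.seg (s + 1) (by omega)
  · intro s hs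
    rcases lt_or_ge s t with h | h
    · rw [if_pos h, if_pos (Nat.succ_le_of_lt h), if_pos (Nat.succ_le_of_lt h)]
      exact c.collider s (by omega)
    · rw [if_neg (by omega), if_neg (by omega), if_neg (by omega)]
      exact c.collider (s + 1) (by omega)
  · intro s hs
    rcases lt_or_ge s t with h | h
    · rw [if_pos h, if_pos (Nat.succ_le_of_lt h), if_pos (Nat.succ_le_of_lt h)]
      exact c.nonCollider s (by omega)
    · rw [if_neg (by omega), if_neg (by omega), if_neg (by omega)]
      exact c.nonCollider (s + 1) (by omega)
  · simp
  · change (if k - 1 ≤ t then _ else _) = _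
    rw [if_neg (by omega), show k - 1 + 1 = k by omega]

/-- Deleting a segment that starts and ends in the same node. -/
theorem exists_cut (hG : G.IsIADMG) (hSZ : S ⊆ Z) (c : G.SegChain S Z k) (t : ℕ) (ht : t < k)
    (hv : c.v t = c.v (t + 1)) :
    ∃ c' : G.SegChain S Z (k - 1), c'.v 0 = c.v 0 ∧ c'.v (k - 1) = c.v k := by
  have hvlast : (if k - 1 ≤ t then c.v (k - 1) else c.v (k - 1 + 1)) = c.v k := by
    split_ifs with h
    · obtain rfl : t = k - 1 := by omega
      rw [hv, show k - 1 + 1 = k by omega]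
    · rw [show k - 1 + 1 = k by omega]
  refine ⟨⟨fun s => if s ≤ t then c.v s else c.v (s + 1),
    fun s => if s < t then c.p s else c.p (s + 1),
    fun s => if s < t then c.q s else c.q (s + 1), ?_, ?_, ?_, ?_, ?_⟩, ?_, ?_⟩
  · simpa using c.first_notMem
  · rw [hvlast]
    exact c.last_notMem
  · intro s hs
    rcases lt_trichotomy s t with h | rfl | h
    · rw [if_pos h.le, if_pos h, if_pos h, if_pos (Nat.succ_le_of_lt h)]
      exact c.seg s (by omega)
    · rw [if_pos le_rfl, if_neg (lt_irrefl _), if_neg (lt_irrefl _), if_neg (by omega), hv]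
      exact c.seg (s + 1) (by omega)
    · rw [if_neg (by omega), if_neg (by omega), if_neg (by omega), if_neg (by omega)]
      exact c.seg (s + 1) (by omega)
  · intro s hs
    rcases lt_trichotomy (s + 1) t with h | rfl | h
    · rw [if_pos (by omega), if_pos h, if_pos h.le]
      exact c.collider s (by omega)
    · rw [if_pos (by omega), if_neg (by omega), if_pos le_rfl]
      intro hq hp
      by_cases hp' : c.p (s + 1) = Mark.arrow
      · exact c.collider s (by omega) hq hp'
      · have hseg := c.seg (s + 1) ht
        rw [← hv] at hseg
        exact ancSet_mono hSZ (hseg.mem_ancSet_of_loop hG hp')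
    · rw [if_neg (by omega), if_neg (by omega), if_neg (by omega)]
      exact c.collider (s + 1) (by omega)
  · intro s hs
    rcases lt_trichotomy (s + 1) t with h | rfl | h
    · rw [if_pos (by omega), if_pos h, if_pos h.le]
      exact c.nonCollider s (by omega)
    · rw [if_pos (by omega), if_neg (by omega), if_pos le_rfl]
      rintro (hq | hp)
      · exact c.nonCollider s (by omega) (Or.inl hq)
      · rw [hv]
        exact c.nonCollider (s + 1) (by omega) (Or.inr hp)
    · rw [if_neg (by omega), if_neg (by omega), if_neg (by omega)]
      exact c.nonCollider (s + 1) (by omega)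
  · simp
  · exact hvlast

end SegChain

end MixedGraph

namespace MixedGraph

variable {N : Type} {M : MixedGraph N}

theorem IsIMAG.mark_of_adj (hM : M.IsIMAG) {a b : N} (h : M.adj a b) :
    M.mark a b = some Mark.tail ∨ M.mark a b = some Mark.arrow := by
  obtain ⟨m, hm⟩ := Option.isSome_iff_exists.mp h
  cases m
  · exact Or.inl hm
  · exact Or.inr hm
  · exact absurd hm (hM.2 a b)

end MixedGraph

namespace RepresentsS

open MixedGraph

variable {N : Type} {M : MixedGraph N} {A' : SADMG N}

theorem mem_nodes (hR : RepresentsS M A') {x : N} (hx : x ∈ A'.graph.nodes) (hxS : x ∉ A'.sel) :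
    x ∈ M.nodes := by
  rw [nodes, hR.1, hR.2.1]
  exact hx.imp id fun h => ⟨h, hxS⟩

theorem adj_of_inducingWalkBtw (hR : RepresentsS M A') {x y : N} (hxy : x ≠ y)
    (hx : x ∈ M.nodes) (hy : y ∈ M.nodes) (hI : ¬ (x ∈ M.inputs ∧ y ∈ M.inputs))
    (h : A'.graph.InducingWalkBtw ∅ A'.sel x y) : M.adj x y :=
  (hR.2.2.1 x y hxy hx hy).2 ⟨hI, inducingPathBtw_of_inducingWalkBtw hxy h⟩

theorem mark_arrow (hM : M.IsIMAG) (hR : RepresentsS M A') {x y : N} (h : M.adj x y)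
    (hx : x ∉ A'.graph.ancSet ({y} ∪ A'.sel)) : M.mark x y = some Mark.arrow :=
  (hM.mark_of_adj h).resolve_left fun ht => hx (hR.2.2.2.2 x y ht)

theorem mark_tail (hM : M.IsIMAG) (hR : RepresentsS M A') {x y : N} (h : M.adj x y)
    (hx : x ∈ A'.graph.ancSet ({y} ∪ A'.sel)) : M.mark x y = some Mark.tail :=
  (hM.mark_of_adj h).resolve_right fun ha => hR.2.2.2.1 x y ha hx

theorem dir_of_dir (hM : M.IsIMAG) (hWF : A'.WF) (hR : RepresentsS M A') {x y : N}
    (h : A'.graph.dir x y) (hxS : x ∉ A'.sel) (hy : y ∉ A'.graph.ancSet A'.sel) :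
    M.dir x y := by
  have hadj := adj_of_mark h.1
  obtain ⟨hxn, hyn⟩ := hWF.1.1.mem_nodes hadj
  have hMadj : M.adj x y := by
    refine hR.adj_of_inducingWalkBtw (hWF.1.1.ne_of_adj hadj) (hR.mem_nodes hxn hxS)
      (hR.mem_nodes hyn fun hs => hy (subset_ancSet _ hs)) ?_
      (Seg.of_edge h.1 h.2).inducingWalkBtw
    rw [hR.1]
    exact fun hI => hWF.1.2.2.2.1 _ hI.2 _ h.2
  refine ⟨hR.mark_tail hM hMadj ?_, hR.mark_arrow hM (hM.1.1.adj_symm hMadj) ?_⟩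
  · rw [mem_ancSet_union, mem_ancSet_singleton]
    exact Or.inl (Relation.ReflTransGen.single h)
  · rw [mem_ancSet_union, mem_ancSet_singleton]
    exact not_or.2 ⟨hWF.1.2.2.1 _ _ h, hy⟩

theorem anc_of_anc (hM : M.IsIMAG) (hWF : A'.WF) (hR : RepresentsS M A') {x y : N}
    (h : A'.graph.anc x y) (hx : x ∉ A'.graph.ancSet A'.sel) : M.anc x y := by
  induction h using Relation.ReflTransGen.head_induction_on with
  | refl => exact Relation.ReflTransGen.refl
  | head h _ ih =>
    have hc := fun hc => hx (mem_ancSet_of_anc (Relation.ReflTransGen.single h) hc)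
    exact Relation.ReflTransGen.head
      (hR.dir_of_dir hM hWF h (fun hs => hx (subset_ancSet _ hs)) hc) (ih hc)

/-- A walk of a represented isADMG that is open given `C ∪ S` yields a `C`-open walk of the
iMAG with the same first node, ending in the same target set. -/
theorem exists_cOpen (hM : M.IsIMAG) (hWF : A'.WF) (hR : RepresentsS M A') {A B C : Set N}
    (hA : A ⊆ M.nodes) (hB : B ⊆ M.nodes) (w : GWalk A'.graph) (hwA : w.first ∈ A)
    (hwB : w.last ∈ B ∪ A'.graph.inputs) (hw : COpen A'.graph (C ∪ A'.sel) w) :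
    ∃ w' : GWalk M, w'.first ∈ A ∧ w'.last ∈ B ∪ M.inputs ∧ COpen M C w' := by
  have hG := hWF.1
  let P : ℕ → Prop := fun k =>
    ∃ c : A'.graph.SegChain A'.sel (C ∪ A'.sel) k, c.v 0 ∈ A ∧ c.v k ∈ B ∪ M.inputs
  have hP : ∃ k, P k := by
    obtain ⟨c, hc⟩ := SegChain.exists_of_cOpen (S := A'.sel) hG.1 w hw
    refine ⟨w.len, c, ?_, ?_⟩
    · rwa [hc]
    · rwa [hc, hR.1]
  obtain ⟨k, ⟨c, hcA, hcB⟩, hmin⟩ : ∃ k, P k ∧ ∀ m < k, ¬ P m :=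
    ⟨Nat.find hP, Nat.find_spec hP, fun m hm => Nat.find_min hP hm⟩
  have hmerge : ∀ t, t + 1 < k → c.q t = Mark.arrow → c.p (t + 1) = Mark.arrow →
      c.v (t + 1) ∉ A'.graph.ancSet ({c.v t, c.v (t + 2)} ∪ A'.sel) := by
    intro t ht hq hp hv
    obtain ⟨c', h0, h1⟩ := c.exists_merge t ht hq hp hv
    exact hmin (k - 1) (by omega) ⟨c', h0 ▸ hcA, h1 ▸ hcB⟩
  have hne : ∀ t < k, c.v t ≠ c.v (t + 1) := by
    intro t ht hv
    obtain ⟨c', h0, h1⟩ := c.exists_cut hG Set.subset_union_right t ht hv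
    exact hmin (k - 1) (by omega) ⟨c', h0 ▸ hcA, h1 ▸ hcB⟩
  have hinput : ∀ t < k, c.v t ∉ M.inputs := by
    intro t ht hI
    have hv : c.v t ∉ C ∪ A'.sel := by
      cases t with
      | zero => exact c.first_notMem
      | succ s =>
        refine c.nonCollider s ht (Or.inr fun hp => ?_)
        obtain ⟨u, hu⟩ := (c.seg (s + 1) ht).exists_mark
        exact hG.2.2.2.1 _ (hR.1 ▸ hI) u (hp ▸ hu)
    exact hmin t ht ⟨c.take t ht.le hv, hcA, Or.inr hI⟩
  have hnodes : ∀ t ≤ k, c.v t ∈ M.nodes := by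
    intro t ht
    rcases t.eq_zero_or_pos with rfl | hpos
    · exact hA hcA
    rcases ht.eq_or_lt with rfl | hlt
    · exact hcB.elim (fun h => hB h) Or.inl
    obtain ⟨s, rfl⟩ : ∃ s, t = s + 1 := ⟨t - 1, by omega⟩
    obtain ⟨u, hu⟩ := (c.seg (s + 1) hlt).exists_mark
    refine hR.mem_nodes (hG.1.mem_nodes (adj_of_mark hu)).1 fun hs => ?_
    by_cases hcol : c.q s = Mark.arrow ∧ c.p (s + 1) = Mark.arrow
    · exact hmerge s hlt hcol.1 hcol.2 (subset_ancSet _ (Or.inr hs))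
    · exact c.nonCollider s hlt (not_and_or.1 hcol) (Or.inr hs)
  have hadj : ∀ t < k, M.adj (c.v t) (c.v (t + 1)) := fun t ht =>
    hR.adj_of_inducingWalkBtw (hne t ht) (hnodes t ht.le) (hnodes (t + 1) ht)
      (fun h => hinput t ht h.1) (c.seg t ht).inducingWalkBtw
  refine ⟨⟨k, c.v, hadj⟩, hcA, hcB, fun h => c.first_notMem (Or.inl h),
    fun h => c.last_notMem (Or.inl h), ?_⟩
  intro i hi hi'
  obtain ⟨t, rfl⟩ : ∃ t, i = t + 1 := ⟨i - 1, by omega⟩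
  change t + 1 < k at hi'
  have hl := hM.1.1.adj_symm (hadj t (by omega))
  have hr := hadj (t + 1) hi'
  simp only [GWalk.ColliderAt, Nat.add_sub_cancel]
  by_cases hcol : c.q t = Mark.arrow ∧ c.p (t + 1) = Mark.arrow
  · have hnot := hmerge t hi' hcol.1 hcol.2
    have hmarks : M.mark (c.v (t + 1)) (c.v t) = some Mark.arrow ∧
        M.mark (c.v (t + 1)) (c.v (t + 1 + 1)) = some Mark.arrow :=
      ⟨hR.mark_arrow hM hl fun h => hnot (ancSet_mono (by grind) h),
        hR.mark_arrow hM hr fun h => hnot (ancSet_mono (by grind) h)⟩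
    refine ⟨fun h => absurd hmarks h, fun _ => ?_⟩
    have hnS : c.v (t + 1) ∉ A'.graph.ancSet A'.sel := fun h =>
      hnot (ancSet_mono Set.subset_union_right h)
    obtain ⟨s, hs, hanc⟩ :=
      (mem_ancSet_union.1 (c.collider t hi' hcol.1 hcol.2)).resolve_right hnS
    exact ⟨s, hs, hR.anc_of_anc hM hWF hanc hnS⟩
  · have hnon := not_and_or.1 hcol
    refine ⟨fun _ h => c.nonCollider t hi' hnon (Or.inl h), fun h => ?_⟩
    rcases hnon with hq | hp
    · exact absurd (((c.seg t (by omega)).symm hG.1).mem_ancSet_left hG hq)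
        (hR.2.2.2.1 _ _ h.1)
    · exact absurd ((c.seg (t + 1) hi').mem_ancSet_left hG hp) (hR.2.2.2.1 _ _ h.2)

end RepresentsS

namespace MixedGraph

variable {N : Type} {M : MixedGraph N} {s : Sym2 N → N}

/-- `z` is the selection node labelling an undirected edge of `M` at `x`. -/
def SelEdge (M : MixedGraph N) (s : Sym2 N → N) (x z : N) : Prop :=
  ∃ y, M.undir x y ∧ s s(x, y) = z

/-- The isADMG obtained from `M` by replacing each undirected edge `x − y` by
`x → s(x,y) ← y`, where `s(x,y)` is a new selection node. -/
def splitUndir (M : MixedGraph N) (s : Sym2 N → N) : SADMG N where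
  graph :=
    { inputs := M.inputs
      outputs := M.outputs ∪ {z | ∃ x, M.SelEdge s x z}
      mark := fun x y =>
        if M.undir x y then none
        else if M.SelEdge s x y then some Mark.tail
        else if M.SelEdge s y x then some Mark.arrow
        else M.mark x y }
  sel := {z | ∃ x, M.SelEdge s x z}

/-- `s` assigns distinct new nodes to the unordered pairs of nodes of `M`. -/
def IsFreshLabelling (M : MixedGraph N) (s : Sym2 N → N) : Prop :=
  (∀ e, s e ∉ M.nodes) ∧ Set.InjOn s {e | ∀ x ∈ e, x ∈ M.nodes}

theorem exists_isFreshLabelling [Infinite N] (hM : M.WF) : ∃ s, M.IsFreshLabelling s := by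
  have hfin : M.nodes.Finite := hM.2.1.union hM.2.2.1
  have hT : {e : Sym2 N | ∀ x ∈ e, x ∈ M.nodes}.Finite := by
    refine ((hfin.prod hfin).image fun p => s(p.1, p.2)).subset ?_
    intro e he
    induction e using Sym2.ind with
    | _ a b => exact ⟨(a, b), ⟨he a (by simp), he b (by simp)⟩, rfl⟩
  obtain ⟨g, hg⟩ := Set.countable_iff_exists_injOn.1 hT.countable
  let n := hfin.infinite_compl.natEmbedding
  refine ⟨fun e => n (g e), fun e => (n (g e)).2, fun a ha b hb hab => hg ha hb ?_⟩
  exact n.injective (Subtype.ext hab)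

theorem undir.symm {x y : N} (h : M.undir x y) : M.undir y x := ⟨h.2, h.1⟩

theorem undir.mem_nodes (hM : M.WF) {x y : N} (h : M.undir x y) : x ∈ M.nodes ∧ y ∈ M.nodes :=
  hM.mem_nodes (adj_of_mark h.1)

namespace SelEdge

theorem left_mem (hM : M.WF) {x z : N} (h : M.SelEdge s x z) : x ∈ M.nodes := by
  obtain ⟨y, h, -⟩ := h
  exact (h.mem_nodes hM).1

theorem right_notMem (hs : M.IsFreshLabelling s) {x z : N} (h : M.SelEdge s x z) :
    z ∉ M.nodes := by
  obtain ⟨y, -, rfl⟩ := h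
  exact hs.1 _

theorem eq_or_undir (hM : M.WF) (hs : M.IsFreshLabelling s) {x y z : N}
    (hx : M.SelEdge s x z) (hy : M.SelEdge s y z) : x = y ∨ M.undir x y := by
  obtain ⟨x', hx, rfl⟩ := hx
  obtain ⟨y', hy, h⟩ := hy
  have hmem : ∀ {u v : N}, M.undir u v → s(u, v) ∈ {e : Sym2 N | ∀ x ∈ e, x ∈ M.nodes} := by
    intro u v huv w hw
    rcases Sym2.mem_iff.1 hw with rfl | rfl
    exacts [(huv.mem_nodes hM).1, (huv.mem_nodes hM).2]
  rcases Sym2.eq_iff.1 (hs.2 (hmem hy) (hmem hx) h) with ⟨h1, -⟩ | ⟨h1, h2⟩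
  · exact Or.inl h1.symm
  · exact Or.inr (h1 ▸ hx)

end SelEdge

theorem splitUndir_mark_arrow (hM : M.WF) (hs : M.IsFreshLabelling s) {x y : N} :
    (M.splitUndir s).graph.mark x y = some Mark.arrow ↔
      M.mark x y = some Mark.arrow ∨ M.SelEdge s y x := by
  have h1 : M.undir x y → M.mark x y ≠ some Mark.arrow := by
    intro h
    simp [h.1]
  have h2 : M.undir x y → ¬ M.SelEdge s y x := fun h h' =>
    h'.right_notMem hs (h.mem_nodes hM).1
  have h3 : M.SelEdge s x y → M.mark x y ≠ some Mark.arrow := fun h h' =>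
    h.right_notMem hs (hM.mem_nodes (adj_of_mark h')).2
  have h4 : M.SelEdge s x y → ¬ M.SelEdge s y x := fun h h' =>
    h.right_notMem hs (h'.left_mem hM)
  simp only [splitUndir]
  split_ifs <;> simp_all

theorem splitUndir_mark_tail (hM : M.IsIMAG) (hs : M.IsFreshLabelling s) {x y : N} :
    (M.splitUndir s).graph.mark x y = some Mark.tail ↔ M.dir x y ∨ M.SelEdge s x y := by
  have hWF := hM.1.1
  have h1 : M.undir x y → ¬ M.dir x y := by
    intro h h'
    simp [dir, h.2] at h'
  have h2 : M.undir x y → ¬ M.SelEdge s x y := fun h h' =>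
    h'.right_notMem hs (h.mem_nodes hWF).2
  have h3 : M.SelEdge s y x → ¬ M.dir x y := fun h h' =>
    h.right_notMem hs (hWF.mem_nodes (adj_of_mark h'.1)).1
  have h4 : ¬ M.undir x y → (M.mark x y = some Mark.tail ↔ M.dir x y) := fun h =>
    ⟨fun h' => ⟨h', (hM.mark_of_adj (hWF.adj_symm (adj_of_mark h'))).resolve_left
      fun h'' => h ⟨h', h''⟩⟩, fun h' => h'.1⟩
  simp only [splitUndir]
  split_ifs <;> simp_all

theorem splitUndir_dir (hM : M.IsIMAG) (hs : M.IsFreshLabelling s) {x y : N} :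
    (M.splitUndir s).graph.dir x y ↔ M.dir x y ∨ M.SelEdge s x y := by
  rw [dir, splitUndir_mark_tail hM hs, splitUndir_mark_arrow hM.1.1 hs]
  exact ⟨fun h => h.1, fun h => ⟨h, h.imp_left And.right⟩⟩

theorem splitUndir_adj (hM : M.IsIMAG) (hs : M.IsFreshLabelling s) {x y : N} :
    (M.splitUndir s).graph.adj x y ↔
      (M.adj x y ∧ ¬ M.undir x y) ∨ M.SelEdge s x y ∨ M.SelEdge s y x := by
  have hWF := hM.1.1
  have h1 : ∀ {x y}, M.undir x y → ¬ M.SelEdge s x y := fun h h' =>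
    h'.right_notMem hs (h.mem_nodes hWF).2
  have h2 : M.undir x y → ¬ M.SelEdge s y x := fun h => h1 h.symm
  have h3 : M.undir x y → ¬ M.SelEdge s x y := h1
  simp only [splitUndir, adj]
  split_ifs <;> simp_all

theorem splitUndir_nodes : (M.splitUndir s).graph.nodes = M.nodes ∪ (M.splitUndir s).sel := by
  simp [nodes, splitUndir, Set.union_assoc]

theorem splitUndir_anc_of_anc (hM : M.IsIMAG) (hs : M.IsFreshLabelling s) {x y : N}
    (h : M.anc x y) : (M.splitUndir s).graph.anc x y :=
  Relation.ReflTransGen.mono (fun _ _ h => (splitUndir_dir hM hs).2 (Or.inl h)) _ _ h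

theorem left_mem_of_splitUndir_dir (hM : M.IsIMAG) (hs : M.IsFreshLabelling s) {x y : N}
    (h : (M.splitUndir s).graph.dir x y) : x ∈ M.nodes := by
  rcases (splitUndir_dir hM hs).1 h with h | h
  · exact (hM.1.1.mem_nodes (adj_of_mark h.1)).1
  · exact h.left_mem hM.1.1

theorem anc_of_splitUndir_anc (hM : M.IsIMAG) (hs : M.IsFreshLabelling s) {x y : N}
    (h : (M.splitUndir s).graph.anc x y) (hy : y ∈ M.nodes) : M.anc x y := by
  induction h using Relation.ReflTransGen.head_induction_on with
  | refl => exact Relation.ReflTransGen.refl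
  | @head x c h h' ih =>
    rcases (splitUndir_dir hM hs).1 h with h | h
    · exact Relation.ReflTransGen.head h ih
    · rcases h'.cases_head with rfl | ⟨d, hd, -⟩
      · exact absurd hy (h.right_notMem hs)
      · exact absurd (left_mem_of_splitUndir_dir hM hs hd) (h.right_notMem hs)

theorem exists_undir_of_mem_ancSet (hM : M.IsIMAG) (hs : M.IsFreshLabelling s) {x : N}
    (hx : x ∈ M.nodes) (h : x ∈ (M.splitUndir s).graph.ancSet (M.splitUndir s).sel) :
    ∃ y, M.undir x y := by
  obtain ⟨z, ⟨u, hu⟩, h⟩ := h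
  rcases h.cases_tail with rfl | ⟨c, hxc, hcz⟩
  · exact absurd hx (hu.right_notMem hs)
  rcases (splitUndir_dir hM hs).1 hcz with hcz | hcz
  · exact absurd (hM.1.1.mem_nodes (adj_of_mark hcz.1)).2 (hu.right_notMem hs)
  have hanc := anc_of_splitUndir_anc hM hs hxc (hcz.left_mem hM.1.1)
  obtain ⟨d, hcd, -⟩ := hcz
  rcases hanc.cases_tail with rfl | ⟨e, -, hec⟩
  · exact ⟨d, hcd⟩
  · exact absurd hcd (hM.1.2.2.2.2.2.1 _ _ _ hec.2)

theorem splitUndir_isIADMG (hM : M.IsIMAG) (hs : M.IsFreshLabelling s) :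
    (M.splitUndir s).graph.IsIADMG := by
  have hWF := hM.1.1
  have hfin : M.nodes.Finite := hWF.2.1.union hWF.2.2.1
  have hmem : ∀ a b, (M.splitUndir s).graph.adj a b → a ∈ (M.splitUndir s).graph.nodes := by
    intro a b h
    rw [splitUndir_nodes]
    rcases (splitUndir_adj hM hs).1 h with h | h | h
    · exact Or.inl (hWF.mem_nodes h.1).1
    · exact Or.inl (h.left_mem hWF)
    · exact Or.inr ⟨b, h⟩
  have hsymm : ∀ a b, (M.splitUndir s).graph.adj a b → (M.splitUndir s).graph.adj b a := by
    intro a b h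
    rw [splitUndir_adj hM hs] at h ⊢
    rcases h with h | h | h
    · exact Or.inl ⟨hWF.adj_symm h.1, fun h' => h.2 h'.symm⟩
    · exact Or.inr (Or.inr h)
    · exact Or.inr (Or.inl h)
  refine ⟨⟨?_, hWF.2.1, ?_, hsymm, ?_, fun a b h => ⟨hmem a b h, hmem b a (hsymm a b h)⟩⟩,
    ?_, ?_, ?_, ?_⟩
  · refine Set.disjoint_union_right.2 ⟨hWF.1, Set.disjoint_left.2 ?_⟩
    rintro a ha ⟨x, hx⟩
    exact hx.right_notMem hs (Or.inl ha)
  · refine hWF.2.2.1.union (((hfin.prod hfin).image fun p => s s(p.1, p.2)).subset ?_)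
    rintro z ⟨x, y, h, rfl⟩
    exact ⟨(x, y), h.mem_nodes hWF, rfl⟩
  · intro a
    rw [← Option.not_isSome_iff_eq_none]
    intro h
    rcases (splitUndir_adj hM hs).1 h with h | h | h
    · exact hWF.ne_of_adj h.1 rfl
    · exact h.right_notMem hs (h.left_mem hWF)
    · exact h.right_notMem hs (h.left_mem hWF)
  · intro a b h
    rw [splitUndir_dir hM hs, splitUndir_dir hM hs, bidir, splitUndir_mark_arrow hWF hs,
      splitUndir_mark_arrow hWF hs]
    rcases (splitUndir_adj hM hs).1 h with ⟨h, h'⟩ | h | h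
    · have h1 := hM.mark_of_adj h
      have h2 := hM.mark_of_adj (hWF.adj_symm h)
      simp only [undir, dir] at h' ⊢
      tauto
    · exact Or.inl (Or.inr h)
    · exact Or.inr (Or.inl (Or.inr h))
  · intro a b h hba
    have hanc := anc_of_splitUndir_anc hM hs hba (left_mem_of_splitUndir_dir hM hs h)
    rcases (splitUndir_dir hM hs).1 h with h | h
    · exact hM.1.2.2.2.1 _ _ h hanc
    · rcases hba.cases_head with rfl | ⟨d, hd, -⟩
      · exact h.right_notMem hs (h.left_mem hWF)
      · exact h.right_notMem hs (left_mem_of_splitUndir_dir hM hs hd)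
  · intro a ha b h
    rcases (splitUndir_mark_arrow hWF hs).1 h with h | h
    · exact hM.1.2.1 a ha b h
    · exact h.right_notMem hs (Or.inl ha)
  · intro a ha b hb h
    rcases (splitUndir_adj hM hs).1 h with h | h | h
    · exact hM.1.2.2.1 a ha b hb h.1
    · exact h.right_notMem hs (Or.inl hb)
    · exact h.right_notMem hs (Or.inl ha)

theorem adj_of_splitUndir_inducingPathBtw (hM : M.IsIMAG) (hs : M.IsFreshLabelling s) {a b : N}
    (hab : a ≠ b) (ha : a ∈ M.nodes) (hb : b ∈ M.nodes)
    (h : (M.splitUndir s).graph.InducingPathBtw ∅ (M.splitUndir s).sel a b) : M.adj a b := by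
  have hWF := hM.1.1
  obtain ⟨w, hpath, hfirst, hlast, hind⟩ := h
  have hcol : ∀ i, 0 < i → i < w.len → w.ColliderAt i := by
    intro i h0 hi
    simpa using hind.1 i h0 hi
  by_cases hint : ∀ i, 0 < i → i < w.len → w.f i ∈ M.nodes
  · have hnodes : ∀ i ≤ w.len, w.f i ∈ M.nodes := by
      intro i hi
      rcases i.eq_zero_or_pos with rfl | hpos
      · rwa [show w.f 0 = a from hfirst]
      rcases hi.eq_or_lt with rfl | hlt
      · rwa [show w.f w.len = b from hlast]
      · exact hint i hpos hlt
    have harrow : ∀ i ≤ w.len, ∀ j,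
        (M.splitUndir s).graph.mark (w.f i) (w.f j) = some Mark.arrow →
          M.mark (w.f i) (w.f j) = some Mark.arrow := fun i hi j h =>
      ((splitUndir_mark_arrow hWF hs).1 h).resolve_right fun h =>
        h.right_notMem hs (hnodes i hi)
    have hadj : ∀ i < w.len, M.adj (w.f i) (w.f (i + 1)) := by
      intro i hi
      rcases (splitUndir_adj hM hs).1 (w.hadj i hi) with h | h | h
      · exact h.1
      · exact absurd (hnodes (i + 1) hi) (h.right_notMem hs)
      · exact absurd (hnodes i hi.le) (h.right_notMem hs)
    by_contra hnadj
    refine hM.1.2.2.2.2.2.2 a b hab ha hb hnadj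
      ⟨⟨w.len, w.f, hadj⟩, hpath, hfirst, hlast, fun i h0 hi => Or.inr ?_, fun i h0 hi _ => ?_⟩
    · obtain ⟨h1, h2⟩ := hcol i h0 hi
      exact ⟨harrow i (le_of_lt hi) _ h1, harrow i (le_of_lt hi) _ h2⟩
    · change i < w.len at hi
      change w.f i ∈ M.ancSet ({w.first, w.last} ∪ ∅)
      rcases mem_ancSet_union.1 (hind.2 i h0 hi (hcol i h0 hi)) with ⟨c, hc, hanc⟩ | hsel
      · refine ⟨c, Or.inl hc, anc_of_splitUndir_anc hM hs hanc ?_⟩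
        rcases hc with rfl | rfl
        exacts [hfirst ▸ ha, hlast ▸ hb]
      · obtain ⟨y, hy⟩ := exists_undir_of_mem_ancSet hM hs (hint i h0 hi) hsel
        exact absurd hy (hM.1.2.2.2.2.2.1 _ _ _ (harrow i hi.le _ (hcol i h0 hi).1))
  · push Not at hint
    obtain ⟨i, h0, hi, hnot⟩ := hint
    have hedge : ∀ {j}, (M.splitUndir s).graph.mark (w.f i) (w.f j) = some Mark.arrow →
        M.SelEdge s (w.f j) (w.f i) := fun h =>
      ((splitUndir_mark_arrow hWF hs).1 h).resolve_left fun h =>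
        hnot (hWF.mem_nodes (adj_of_mark h)).1
    have hnoarrow : ∀ {j}, M.SelEdge s (w.f j) (w.f i) →
        (M.splitUndir s).graph.mark (w.f j) (w.f i) ≠ some Mark.arrow := by
      intro j h h'
      rcases (splitUndir_mark_arrow hWF hs).1 h' with h' | h'
      · exact hnot (hWF.mem_nodes (adj_of_mark h')).2
      · exact hnot (h'.left_mem hWF)
    have hl := hedge (hcol i h0 hi).1
    have hr := hedge (hcol i h0 hi).2
    have hi1 : i = 1 := by
      by_contra hne
      refine hnoarrow hl ?_
      simpa [Nat.sub_add_cancel h0] using (hcol (i - 1) (by omega) (by omega)).2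
    have hi2 : i + 1 = w.len := by
      by_contra hne
      exact hnoarrow hr (hcol (i + 1) (by omega) (by omega)).1
    have hfa : w.f (i - 1) = a := by
      rw [hi1]
      exact hfirst
    have hfb : w.f (i + 1) = b := by
      rw [hi2]
      exact hlast
    rw [hfa] at hl
    rw [hfb] at hr
    exact adj_of_mark ((hl.eq_or_undir hWF hs hr).resolve_left hab).1

theorem splitUndir_inducingWalkBtw (hM : M.IsIMAG) (hs : M.IsFreshLabelling s) {a b : N}
    (h : M.adj a b) : (M.splitUndir s).graph.InducingWalkBtw ∅ (M.splitUndir s).sel a b := by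
  by_cases hu : M.undir a b
  · have h1 : M.SelEdge s a (s s(a, b)) := ⟨b, hu, rfl⟩
    have h2 : M.SelEdge s b (s s(a, b)) := ⟨a, hu.symm, by rw [Sym2.eq_swap]⟩
    have hz : s s(a, b) ∈ (M.splitUndir s).sel := ⟨a, h1⟩
    have hd1 := (splitUndir_dir hM hs).2 (Or.inr h1)
    have hd2 := (splitUndir_dir hM hs).2 (Or.inr h2)
    exact ((Seg.of_edge hd1.1 hd1.2).trans (Seg.of_edge hd2.2 hd2.1)
      (subset_ancSet _ (Or.inr hz))).inducingWalkBtw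
  · have h1 := (splitUndir_adj hM hs).2 (Or.inl ⟨h, hu⟩)
    obtain ⟨p, hp⟩ := Option.isSome_iff_exists.mp h1
    obtain ⟨q, hq⟩ := Option.isSome_iff_exists.mp ((splitUndir_isIADMG hM hs).1.adj_symm h1)
    exact (Seg.of_edge hp hq).inducingWalkBtw

theorem splitUndir_wf (hM : M.IsIMAG) (hs : M.IsFreshLabelling s) : (M.splitUndir s).WF :=
  ⟨splitUndir_isIADMG hM hs, Set.subset_union_right⟩

theorem representsS_splitUndir (hM : M.IsIMAG) (hs : M.IsFreshLabelling s) :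
    RepresentsS M (M.splitUndir s) := by
  have hWF := hM.1.1
  refine ⟨rfl, ?_, ?_, ?_, ?_⟩
  · ext x
    simp only [SADMG.obs, splitUndir, Set.mem_sdiff, Set.mem_union, Set.mem_ofPred_eq]
    refine ⟨fun hx => ⟨Or.inl hx, ?_⟩, fun hx => hx.1.resolve_right hx.2⟩
    rintro ⟨y, hy⟩
    exact hy.right_notMem hs (Or.inr hx)
  · intro a b hab ha hb
    refine ⟨fun h => ⟨fun hI => hM.1.2.2.1 a hI.1 b hI.2 h, ?_⟩, fun h =>
      adj_of_splitUndir_inducingPathBtw hM hs hab ha hb h.2⟩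
    exact inducingPathBtw_of_inducingWalkBtw hab (splitUndir_inducingWalkBtw hM hs h)
  · intro a b h h'
    obtain ⟨ha, hb⟩ := hWF.mem_nodes (adj_of_mark h)
    rcases mem_ancSet_union.1 h' with h' | h'
    · have hanc := anc_of_splitUndir_anc hM hs (mem_ancSet_singleton.1 h') hb
      rcases hM.mark_of_adj (hWF.adj_symm (adj_of_mark h)) with h'' | h''
      · exact hM.1.2.2.2.1 b a ⟨h'', h⟩ hanc
      · exact hM.1.2.2.2.2.1 a b hanc ⟨h'', h⟩
    · obtain ⟨y, hy⟩ := exists_undir_of_mem_ancSet hM hs ha h'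
      exact hM.1.2.2.2.2.2.1 _ _ _ h hy
  · intro a b h
    rcases hM.mark_of_adj (hWF.adj_symm (adj_of_mark h)) with h' | h'
    · refine ⟨s s(a, b), Or.inr ⟨a, b, ⟨h, h'⟩, rfl⟩, Relation.ReflTransGen.single ?_⟩
      exact (splitUndir_dir hM hs).2 (Or.inr ⟨b, ⟨h, h'⟩, rfl⟩)
    · refine ⟨b, Or.inl rfl, Relation.ReflTransGen.single ?_⟩
      exact (splitUndir_dir hM hs).2 (Or.inl ⟨h, h'⟩)

/-- There is a nontrivial walk from `a` to `b` whose interior is `Z`-open and whose last edge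
carries the mark `m` at `b`. -/
def OpenTo (G : MixedGraph N) (Z : Set N) (a b : N) (m : Mark) : Prop :=
  ∃ w : GWalk G, 0 < w.len ∧ w.first = a ∧ w.last = b ∧
    G.mark b (w.f (w.len - 1)) = some m ∧
    ∀ i, 0 < i → i < w.len →
      (¬ w.ColliderAt i → w.f i ∉ Z) ∧ (w.ColliderAt i → w.f i ∈ G.ancSet Z)

namespace OpenTo

variable {G : MixedGraph N} {Z : Set N} {a b c : N} {m p q : Mark}

theorem of_edge (hp : G.mark a b = some p) (hq : G.mark b a = some q) : G.OpenTo Z a b q := by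
  refine ⟨⟨1, fun i => if i = 0 then a else b, ?_⟩, one_pos, by simp [GWalk.first],
    by simp [GWalk.last], by simpa, ?_⟩
  · intro i hi
    obtain rfl : i = 0 := by omega
    simpa using adj_of_mark hp
  · intro i h0 h1
    change i < 1 at h1
    omega

theorem snoc (h : G.OpenTo Z a b m) (hp : G.mark b c = some p) (hq : G.mark c b = some q)
    (hnon : ¬ (m = Mark.arrow ∧ p = Mark.arrow) → b ∉ Z)
    (hcol : m = Mark.arrow ∧ p = Mark.arrow → b ∈ G.ancSet Z) : G.OpenTo Z a c q := by
  obtain ⟨w, hpos, hfirst, hlast, hm, hint⟩ := h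
  let f : ℕ → N := fun i => if i ≤ w.len then w.f i else c
  have f_le : ∀ i, i ≤ w.len → f i = w.f i := fun i hi => if_pos hi
  have f_last : f (w.len + 1) = c := if_neg (by omega)
  have f_len : f w.len = b := (f_le _ le_rfl).trans hlast
  refine ⟨⟨w.len + 1, f, ?_⟩, Nat.succ_pos _, (f_le 0 (Nat.zero_le _)).trans hfirst, f_last,
    ?_, ?_⟩
  · intro i hi
    rcases (Nat.lt_succ_iff.1 hi).eq_or_lt with rfl | hlt
    · rw [f_len, f_last]
      exact adj_of_mark hp
    · rw [f_le i hlt.le, f_le (i + 1) hlt]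
      exact w.hadj i hlt
  · change G.mark c (f (w.len + 1 - 1)) = some q
    rwa [Nat.add_sub_cancel, f_len]
  · intro i h0 hi
    change i < w.len + 1 at hi
    simp only [GWalk.ColliderAt]
    rcases (Nat.lt_succ_iff.1 hi).eq_or_lt with rfl | hlt
    · rw [f_len, f_last, f_le (w.len - 1) (Nat.sub_le _ _), hm, hp, Option.some_inj,
        Option.some_inj]
      exact ⟨hnon, hcol⟩
    · rw [f_le i hlt.le, f_le (i + 1) hlt, f_le (i - 1) (by omega)]
      exact hint i h0 hlt

end OpenTo

theorem splitUndir_openTo (hM : M.IsIMAG) (hs : M.IsFreshLabelling s) {C : Set N}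
    (w : GWalk M) (hw : COpen M C w) (k : ℕ) (hk : k < w.len) :
    ∃ m, M.mark (w.f (k + 1)) (w.f k) = some m ∧
      (M.splitUndir s).graph.OpenTo (C ∪ (M.splitUndir s).sel) (w.f 0) (w.f (k + 1)) m := by
  have hWF := hM.1.1
  have hnsel : ∀ x ∈ M.nodes, x ∉ (M.splitUndir s).sel := by
    rintro x hx ⟨y, hy⟩
    exact hy.right_notMem hs hx
  have hedge : ∀ {x y : N} {p q : Mark}, M.mark x y = some p → M.mark y x = some q →
      ¬ M.undir x y → (M.splitUndir s).graph.mark x y = some p ∧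
        (M.splitUndir s).graph.mark y x = some q := by
    intro x y p q hp hq hu
    obtain ⟨hx, hy⟩ := hWF.mem_nodes (adj_of_mark hp)
    have h1 : ¬ M.SelEdge s x y := fun h => h.right_notMem hs hy
    have h2 : ¬ M.SelEdge s y x := fun h => h.right_notMem hs hx
    have hu' : ¬ M.undir y x := fun h => hu h.symm
    simp [splitUndir, h1, h2, hu, hu', hp, hq]
  have hsel : ∀ {x y : N}, M.undir x y → s s(x, y) ∈ (M.splitUndir s).sel ∧
      (M.splitUndir s).graph.dir x (s s(x, y)) ∧ (M.splitUndir s).graph.dir y (s s(x, y)) := by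
    intro x y h
    have h1 : M.SelEdge s x (s s(x, y)) := ⟨y, h, rfl⟩
    have h2 : M.SelEdge s y (s s(x, y)) := ⟨x, h.symm, by rw [Sym2.eq_swap]⟩
    exact ⟨⟨x, h1⟩, (splitUndir_dir hM hs).2 (Or.inr h1), (splitUndir_dir hM hs).2 (Or.inr h2)⟩
  induction k with
  | zero =>
    obtain ⟨p, hp⟩ := Option.isSome_iff_exists.mp (w.hadj 0 hk)
    obtain ⟨q, hq⟩ := Option.isSome_iff_exists.mp (hWF.adj_symm (w.hadj 0 hk))
    refine ⟨q, hq, ?_⟩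
    by_cases hu : M.undir (w.f 0) (w.f (0 + 1))
    · obtain rfl : Mark.tail = q := Option.some.inj (hu.2.symm.trans hq)
      obtain ⟨hz, hd1, hd2⟩ := hsel hu
      exact (OpenTo.of_edge hd1.1 hd1.2).snoc hd2.2 hd2.1 (fun h => absurd ⟨rfl, rfl⟩ h)
        fun _ => subset_ancSet _ (Or.inr hz)
    · obtain ⟨hp', hq'⟩ := hedge hp hq hu
      exact OpenTo.of_edge hp' hq'
  | succ k ih =>
    obtain ⟨m, hm, hopen⟩ := ih (by omega)
    obtain ⟨p, hp⟩ := Option.isSome_iff_exists.mp (w.hadj (k + 1) hk)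
    obtain ⟨q, hq⟩ := Option.isSome_iff_exists.mp (hWF.adj_symm (w.hadj (k + 1) hk))
    refine ⟨q, hq, ?_⟩
    have hint := hw.2.2 (k + 1) k.succ_pos hk
    simp only [GWalk.ColliderAt, Nat.add_sub_cancel, hm, hp, Option.some_inj] at hint
    have hnode := (hWF.mem_nodes (adj_of_mark hp)).1
    have hnon : ¬ (m = Mark.arrow ∧ p = Mark.arrow) →
        w.f (k + 1) ∉ C ∪ (M.splitUndir s).sel := fun h h' =>
      h'.elim (hint.1 h) (hnsel _ hnode)
    by_cases hu : M.undir (w.f (k + 1)) (w.f (k + 1 + 1))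
    · obtain rfl : Mark.tail = q := Option.some.inj (hu.2.symm.trans hq)
      obtain rfl : Mark.tail = p := Option.some.inj (hu.1.symm.trans hp)
      obtain ⟨hz, hd1, hd2⟩ := hsel hu
      exact (hopen.snoc hd1.1 hd1.2 hnon (fun h => absurd h.2 (by simp))).snoc hd2.2 hd2.1
        (fun h => absurd ⟨rfl, rfl⟩ h) fun _ => subset_ancSet _ (Or.inr hz)
    · obtain ⟨hp', hq'⟩ := hedge hp hq hu
      refine hopen.snoc hp' hq' hnon fun h => ?_
      obtain ⟨c, hc, hanc⟩ := hint.2 h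
      exact ⟨c, Or.inl hc, splitUndir_anc_of_anc hM hs hanc⟩

theorem exists_cOpen_splitUndir (hM : M.IsIMAG) (hs : M.IsFreshLabelling s) {C : Set N}
    (w : GWalk M) (hw : COpen M C w) (hfirst : w.first ∈ M.nodes) (hlast : w.last ∈ M.nodes) :
    ∃ w' : GWalk (M.splitUndir s).graph, w'.first = w.first ∧ w'.last = w.last ∧
      COpen (M.splitUndir s).graph (C ∪ (M.splitUndir s).sel) w' := by
  have hnotMem : ∀ x ∈ M.nodes, x ∉ C → x ∉ C ∪ (M.splitUndir s).sel := by
    rintro x hx hxC (h | ⟨y, hy⟩)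
    · exact hxC h
    · exact hy.right_notMem hs hx
  rcases w.len.eq_zero_or_pos with h0 | hpos
  · have hlf : w.last = w.first := by rw [GWalk.last, h0, GWalk.first]
    exact ⟨⟨0, w.f, fun i hi => absurd hi (Nat.not_lt_zero i)⟩, rfl, hlf.symm,
      hnotMem _ hfirst hw.1, hnotMem _ hfirst hw.1,
      fun i _ hi => absurd hi (Nat.not_lt_zero i)⟩
  · obtain ⟨m, -, w', -, h1, h2, -, hint⟩ :=
      splitUndir_openTo hM hs w hw (w.len - 1) (by omega)
    rw [Nat.sub_add_cancel hpos] at h2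
    exact ⟨w', h1, h2, h1 ▸ hnotMem _ hfirst hw.1, h2 ▸ hnotMem _ hlast hw.2.1, hint⟩

end MixedGraph

/-- Let `M` be an iMAG.  For all node sets `A, B, C ⊆ I ∪ V`:
`A` is id-separated from `B` given `C` in `M` if and only if, for every isADMG
`A'` represented by `M`, `A` is id-separated from `B` given `C ∪ S_{A'}` in `A'`. -/
theorem statement6 {N : Type} [Infinite N] (M : MixedGraph N) (hM : M.IsIMAG)
    (A B C : Set N) (hA : A ⊆ M.nodes) (hB : B ⊆ M.nodes) (hC : C ⊆ M.nodes) :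
    IdSepSimple M A B C ↔
      ∀ A' : SADMG N, A'.WF → RepresentsS M A' →
        IdSepSimple A'.graph A B (C ∪ A'.sel) := by
  constructor
  · intro h A' hWF hR w hwA hwB hw
    obtain ⟨w', hA', hB', hw'⟩ := hR.exists_cOpen hM hWF hA hB w hwA hwB hw
    exact h w' hA' hB' hw'
  · intro h w hwA hwB hw
    obtain ⟨s, hs⟩ := MixedGraph.exists_isFreshLabelling hM.1.1
    obtain ⟨w', hfirst, hlast, hw'⟩ := MixedGraph.exists_cOpen_splitUndir hM hs w hw (hA hwA)
      (hwB.elim (fun h => hB h) Or.inl)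
    exact h _ (MixedGraph.splitUndir_wf hM hs) (MixedGraph.representsS_splitUndir hM hs) w'
      (hfirst ▸ hwA) (hlast ▸ hwB) hw'

end
end

section
/- Let A=(I,O,S,E) be an isADMG, M:=MAG(A), a∈O, and M̃:=MAG(A_{do(I_a)}). Then the induced subgraph of M̃ on I∪O equals M, and M̃ contains an edge between I_a and a with a tail at I_a. Moreover, if a∉Anc_A(S) then this edge is the directed edge I_a→a, and if a∈Anc_A(S) then it is the undirected edge I_a−a. -/
noncomputable section
open Classical

namespace MixedGraph

variable {N : Type}

/-- In an iMAG representing `A`, every mark is determined by `A`. -/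
theorem mark_eq_of_representsS {P : MixedGraph N} {A : SADMG N} (hP : P.IsIMAG)
    (hrep : RepresentsS P A) (x y : N) :
    P.mark x y =
      if x ≠ y ∧ x ∈ P.nodes ∧ y ∈ P.nodes ∧ ¬(x ∈ P.inputs ∧ y ∈ P.inputs) ∧
          A.graph.InducingPathBtw ∅ A.sel x y then
        (if x ∈ A.graph.ancSet ({y} ∪ A.sel) then some Mark.tail else some Mark.arrow)
      else none := by
  obtain ⟨⟨⟨-, -, -, -, hirr, hnodes⟩, -⟩, hcirc⟩ := hP
  obtain ⟨-, -, hadj, harrow, htail⟩ := hrep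
  split_ifs with h h'
  · obtain ⟨hne, hx, hy, hind⟩ := h
    obtain ⟨m, hm⟩ := Option.isSome_iff_exists.1 ((hadj x y hne hx hy).2 hind)
    cases m with
    | tail => exact hm
    | arrow => exact absurd h' (harrow x y hm)
    | circle => exact absurd hm (hcirc x y)
  · obtain ⟨hne, hx, hy, hind⟩ := h
    obtain ⟨m, hm⟩ := Option.isSome_iff_exists.1 ((hadj x y hne hx hy).2 hind)
    cases m with
    | tail => exact absurd (htail x y hm) h'
    | arrow => exact hm
    | circle => exact absurd hm (hcirc x y)
  · by_contra hne
    have hs : (P.mark x y).isSome := Option.isSome_iff_ne_none.2 hne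
    have hxy : x ≠ y := by
      rintro rfl
      exact hne (hirr x)
    obtain ⟨hx, hy⟩ := hnodes x y hs
    exact h ⟨hxy, hx, hy, (hadj x y hxy hx hy).1 hs⟩

theorem inducingPathBtw_of_adj {G : MixedGraph N} (L S : Set N) {a b : N} (hne : a ≠ b)
    (h : G.adj a b) : G.InducingPathBtw L S a b := by
  refine ⟨⟨1, fun i => if i = 0 then a else b, ?_⟩, ?_, rfl, rfl, ?_, ?_⟩
  · intro i hi
    obtain rfl : i = 0 := by omega
    simpa using h
  · intro i hi j hj hij
    have hi' : i ≤ 1 := hi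
    have hj' : j ≤ 1 := hj
    have hij' : (if i = 0 then a else b) = if j = 0 then a else b := hij
    interval_cases i <;> interval_cases j <;> simp_all
  · intro i hi hi'
    have hi'' : i < 1 := hi'
    omega
  · intro i hi hi'
    have hi'' : i < 1 := hi'
    omega

end MixedGraph

section SoftManip

variable {N : Type} (G : MixedGraph N) (D : Set N)

theorem admgSoftManip_mark_inr_ne_arrow (d : N) (z : N ⊕ N) :
    (admgSoftManip G D).mark (Sum.inr d) z ≠ some Mark.arrow := by
  cases z <;> simp [admgSoftManip]

theorem admgSoftManip_anc_inl {x : N} {z : N ⊕ N} :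
    (admgSoftManip G D).anc (Sum.inl x) z ↔ ∃ y, z = Sum.inl y ∧ G.anc x y := by
  constructor
  · intro h
    induction h with
    | refl => exact ⟨x, rfl, .refl⟩
    | @tail b c _ hbc ih =>
      obtain ⟨y, rfl, hy⟩ := ih
      cases c with
      | inl c => exact ⟨c, rfl, hy.tail hbc⟩
      | inr d => exact absurd hbc.2 (admgSoftManip_mark_inr_ne_arrow G D d _)
  · rintro ⟨y, rfl, h⟩
    induction h with
    | refl => exact .refl
    | tail _ hbc ih => exact .tail ih hbc

theorem admgSoftManip_mem_ancSet_inl {x : N} {T : Set (N ⊕ N)} :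
    Sum.inl x ∈ (admgSoftManip G D).ancSet T ↔ x ∈ G.ancSet (Sum.inl ⁻¹' T) := by
  constructor
  · rintro ⟨s, hs, h⟩
    obtain ⟨y, rfl, hy⟩ := (admgSoftManip_anc_inl G D).1 h
    exact ⟨y, hs, hy⟩
  · rintro ⟨s, hs, h⟩
    exact ⟨Sum.inl s, hs, (admgSoftManip_anc_inl G D).2 ⟨s, rfl, h⟩⟩

theorem preimage_inl_pair_union_image (s t : N) (S : Set N) :
    (Sum.inl ⁻¹' ({Sum.inl s, Sum.inl t} ∪ Sum.inl '' S : Set (N ⊕ N))) = {s, t} ∪ S := by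
  ext
  simp

theorem admgSoftManip_inducingPathBtw_inl {S : Set N} {x y : N} :
    (admgSoftManip G D).InducingPathBtw ∅ (Sum.inl '' S) (Sum.inl x) (Sum.inl y) ↔
      G.InducingPathBtw ∅ S x y := by
  constructor
  · rintro ⟨w, hpath, hfirst, hlast, hcol, hanc⟩
    have hinl : ∀ i ≤ w.len, w.f i = Sum.inl ((w.f i).elim id id) := by
      intro i hi
      cases hwi : w.f i with
      | inl v => rfl
      | inr d =>
        exfalso
        have h0 : i ≠ 0 := by
          rintro rfl
          simp [GWalk.first, hwi] at hfirst
        have h1 : i ≠ w.len := by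
          rintro rfl
          simp [GWalk.last, hwi] at hlast
        obtain h | h := hcol i (by omega) (by omega)
        · exact h
        · have := h.1
          rw [hwi] at this
          exact admgSoftManip_mark_inr_ne_arrow G D d _ this
    have hmark : ∀ i ≤ w.len, ∀ j ≤ w.len,
        G.mark ((w.f i).elim id id) ((w.f j).elim id id) =
          (admgSoftManip G D).mark (w.f i) (w.f j) := by
      intro i hi j hj
      rw [hinl i hi, hinl j hj]
      rfl
    refine ⟨⟨w.len, fun i => (w.f i).elim id id, ?_⟩, ?_, ?_, ?_, ?_, ?_⟩
    · intro i hi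
      have := w.hadj i hi
      simpa only [MixedGraph.adj, hmark i hi.le (i + 1) hi] using this
    · intro i hi j hj hij
      apply hpath i hi j hj
      rw [hinl i hi, hinl j hj]
      exact congrArg Sum.inl hij
    · exact congrArg (Sum.elim id id) hfirst
    · exact congrArg (Sum.elim id id) hlast
    · intro i h0 hi
      have hi' : i < w.len := hi
      refine Or.inr ?_
      have := (hcol i h0 hi).resolve_left id
      exact ⟨(hmark i hi'.le (i - 1) (by omega)).trans this.1,
        (hmark i hi'.le (i + 1) hi').trans this.2⟩
    · intro i h0 hi _
      have hi' : i < w.len := hi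
      have := hanc i h0 hi' ((hcol i h0 hi').resolve_left id)
      rw [hinl i hi'.le, hfirst, hlast, admgSoftManip_mem_ancSet_inl,
        preimage_inl_pair_union_image] at this
      change _ ∈ G.ancSet ({w.first.elim id id, w.last.elim id id} ∪ S)
      rw [hfirst, hlast]
      exact this
  · rintro ⟨w, hpath, rfl, rfl, hcol, hanc⟩
    refine ⟨⟨w.len, fun i => Sum.inl (w.f i), w.hadj⟩, ?_, rfl, rfl, hcol, ?_⟩
    · intro i hi j hj hij
      exact hpath i hi j hj (Sum.inl_injective hij)
    · intro i h0 hi hc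
      rw [admgSoftManip_mem_ancSet_inl]
      have := hanc i h0 hi hc
      rw [← preimage_inl_pair_union_image] at this
      exact this

end SoftManip

/-- Let `A` be an isADMG, `M = MAG(A)`, `a` an observed output
node, and `M̃ = MAG(A_{do(I_a)})`.  Then the induced subgraph of `M̃` on `I ∪ O`
equals `M`, and `M̃` contains an edge between `I_a` and `a` with a tail at `I_a`;
moreover, it is `I_a → a` if `a ∉ Anc_A(S)` and `I_a − a` if `a ∈ Anc_A(S)`. -/
theorem statement7 {N : Type} (A : SADMG N) (hA : A.WF)
    (M : MixedGraph N) (hM : M.IsIMAG) (hrep : RepresentsS M A)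
    (a : N) (ha : a ∈ A.obs)
    (Mt : MixedGraph (N ⊕ N)) (hMt : Mt.IsIMAG)
    (hrept : RepresentsS Mt (A.softManip {a})) :
    Mt.induce (Sum.inl '' M.nodes) = M.sumInl ∧
    Mt.mark (Sum.inr a) (Sum.inl a) = some Mark.tail ∧
    (a ∉ A.graph.ancSet A.sel → Mt.dir (Sum.inr a) (Sum.inl a)) ∧
    (a ∈ A.graph.ancSet A.sel → Mt.undir (Sum.inr a) (Sum.inl a)) := by
  obtain ⟨hin, hout, -⟩ := id hrep
  obtain ⟨hint, houtt, -⟩ := id hrept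
  have hobs : (A.softManip {a}).obs = Sum.inl '' A.obs :=
    (Set.image_sdiff Sum.inl_injective _ _).symm
  have hint' : Mt.inputs = Sum.inl '' M.inputs ∪ Sum.inr '' {a} := by
    rw [hint, hin]
    rfl
  have houtt' : Mt.outputs = Sum.inl '' M.outputs := by rw [houtt, hobs, hout]
  have hnodes : ∀ x, Sum.inl x ∈ Mt.nodes ↔ x ∈ M.nodes := by
    intro x
    simp [MixedGraph.nodes, hint', houtt']
  have hinputs : ∀ x, Sum.inl x ∈ Mt.inputs ↔ x ∈ M.inputs := by
    intro x
    simp [hint']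
  have hmark : ∀ x y, Mt.mark (Sum.inl x) (Sum.inl y) = M.mark x y := by
    intro x y
    have hpre : Sum.inl ⁻¹' ({Sum.inl y} ∪ Sum.inl '' A.sel : Set (N ⊕ N)) = {y} ∪ A.sel := by
      ext
      simp
    rw [MixedGraph.mark_eq_of_representsS hMt hrept, MixedGraph.mark_eq_of_representsS hM hrep]
    simp only [SADMG.softManip, admgSoftManip_mem_ancSet_inl,
      admgSoftManip_inducingPathBtw_inl, hnodes, hinputs, hpre, ne_eq, Sum.inl.injEq]
  have haM : a ∈ M.outputs := hout ▸ ha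
  have hae : Sum.inl a ∈ Mt.nodes := (hnodes a).2 (Or.inr haM)
  have hai : Sum.inl a ∉ Mt.inputs := by
    rw [hinputs]
    exact fun h => Set.disjoint_left.1 hM.1.1.1 h haM
  have hIe : Sum.inr a ∈ Mt.nodes := by simp [MixedGraph.nodes, hint']
  have hdir : (A.softManip {a}).graph.dir (Sum.inr a) (Sum.inl a) := by
    simp [MixedGraph.dir, SADMG.softManip, admgSoftManip]
  have htail : Mt.mark (Sum.inr a) (Sum.inl a) = some Mark.tail := by
    rw [MixedGraph.mark_eq_of_representsS hMt hrept, if_pos, if_pos]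
    · exact ⟨Sum.inl a, by simp, .single hdir⟩
    · exact ⟨Sum.inr_ne_inl, hIe, hae, fun h => hai h.2,
        MixedGraph.inducingPathBtw_of_adj _ _ Sum.inr_ne_inl
          (Option.isSome_iff_exists.2 ⟨_, hdir.1⟩)⟩
  have hhead : Mt.mark (Sum.inl a) (Sum.inr a) =
      if a ∈ A.graph.ancSet A.sel then some Mark.tail else some Mark.arrow := by
    have hpre : Sum.inl ⁻¹' ({Sum.inr a} ∪ Sum.inl '' A.sel : Set (N ⊕ N)) = A.sel := by
      ext
      simp
    rw [MixedGraph.mark_eq_of_representsS hMt hrept, if_pos]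
    · simp only [SADMG.softManip, admgSoftManip_mem_ancSet_inl, hpre]
    · exact ⟨Sum.inl_ne_inr, hae, hIe, fun h => hai h.1,
        MixedGraph.inducingPathBtw_of_adj _ _ Sum.inl_ne_inr
          (Option.isSome_iff_exists.2 ⟨_, hdir.2⟩)⟩
  refine ⟨?_, htail, fun h => ⟨htail, by rw [hhead, if_neg h]⟩,
    fun h => ⟨htail, by rw [hhead, if_pos h]⟩⟩
  have hsub : ∀ x y, (M.mark x y) ≠ none → x ∈ M.nodes ∧ y ∈ M.nodes := fun x y h =>
    hM.1.1.2.2.2.2.2 x y (Option.isSome_iff_ne_none.2 h)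
  simp only [MixedGraph.induce, MixedGraph.sumInl, MixedGraph.mk.injEq]
  refine ⟨?_, ?_, ?_⟩
  · rw [hint']
    ext z
    cases z <;> simp [MixedGraph.nodes]
    exact fun h => Or.inl h
  · rw [houtt']
    exact Set.inter_eq_left.2 (Set.image_mono Set.subset_union_right)
  · funext x y
    cases x with
    | inr d => simp
    | inl x =>
      cases y with
      | inr d => simp
      | inl y =>
        by_cases h : M.mark x y = none
        · simp [hmark, h]
        · simp [hmark, hsub x y h]


end
end
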